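/- arXiv:1208.2382 — 2 statements merged into one kernel-verified Lean document; each statement's English description precedes it below -/
import Mathlib

section
/- Let {Z^{(k)}_t}_{t≥0}, for k ∈ ℕ and k = ∞, be centered Gaussian processes with continuous sample paths, E[(Z^{(k)}_t)²] = 1 for all t, and nonnegative auto-correlations A_k(s,t) = E[Z^{(k)}_s Z^{(k)}_t] ≥ 0, where A_∞(s,t) depends only on t − s. Let b(A_∞) := −lim_{T→∞} (1/T) log P(sup_{t∈[0,T]} Z^{(∞)}_t < 0) (this limit exists in [0,∞]). Assume: (i) there exist η > 1, τ_0 < ∞ and k_0 ∈ ℕ such that A_k(s, s+τ) ≤ τ^{−η} for all k ≥ k_0, all τ ≥ τ_0 and all s ≥ 0; (ii) for every η' > 0, limsup_{M→∞} (1/M) log P(sup_{t∈[0,M]} Z^{(∞)}_t < M^{−η'}) = −b(A_∞); (iii) there exist ζ > 0 and M_1 < ∞ such that for every z ∈ [0,ζ] and M ≥ M_1: P(sup_{t∈[0,M]} Z^{(∞)}_t < z) ≤ liminf_{k→∞} inf_{s≥0} P(sup_{t∈[0,M]} Z^{(k)}_{s+t} < z) ≤ limsup_{k→∞} sup_{s≥0}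 P(sup_{t∈[0,M]} Z^{(k)}_{s+t} < z) ≤ P(sup_{t∈[0,M]} Z^{(∞)}_t ≤ z). Then, as k and T tend to infinity jointly, (1/T) log P(sup_{t∈[0,T]} Z^{(k)}_t < 0) converges to −b(A_∞), i.e. for every ε > 0 (and, if b(A_∞) = ∞, for every level −N) there exist k_1 and T_1 such that for all k ≥ k_1 and T ≥ T_1 the quantity (1/T) log P(sup_{t∈[0,T]} Z^{(k)}_t < 0) is within ε of −b(A_∞) (respectively, below −N). -/
open MeasureTheory ProbabilityTheory Filter Set

noncomputable section

/-- A real random variable is centered Gaussian if its law is `gaussianReal 0 v`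
for some variance `v ≥ 0`. -/
def IsCenteredGaussian {Ω : Type*} [MeasurableSpace Ω] (μ : Measure Ω) (X : Ω → ℝ) : Prop :=
  ∃ v : NNReal, Measure.map X μ = gaussianReal 0 v

/-- A centered Gaussian process: every finite linear combination of its values is a
centered Gaussian real random variable. -/
def IsCenteredGaussianProcess {Ω : Type*} [MeasurableSpace Ω] (μ : Measure Ω)
    {T : Type*} (Z : T → Ω → ℝ) : Prop :=
  ∀ (n : ℕ) (c : Fin n → ℝ) (t : Fin n → T),
    IsCenteredGaussian μ (fun ω => ∑ i, c i * Z (t i) ω)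



lemma taylor3 (g g1 g2 g3 : ℝ → ℝ) (K : ℝ) (h0 : ∀ r, HasDerivAt g (g1 r) r)
    (h1 : ∀ r, HasDerivAt g1 (g2 r) r) (h2 : ∀ r, HasDerivAt g2 (g3 r) r)
    (hK : ∀ r, |g3 r| ≤ K) : |g 1 - (g 0 + g1 0 + g2 0 / 2)| ≤ K := by
  have key : ∀ (f f' : ℝ → ℝ), (∀ r, HasDerivAt f (f' r) r) → (∀ r ∈ Icc (0:ℝ) 1, |f' r| ≤ K) →
      ∀ r ∈ Icc (0:ℝ) 1, |f r - f 0| ≤ K := by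
    intro f f' hf hb r hr
    have hK0 : 0 ≤ K := (abs_nonneg _).trans (hK 0)
    have := (convex_Icc (0:ℝ) 1).norm_image_sub_le_of_norm_hasDerivWithin_le
      (f := f) (f' := f') (C := K) (fun x hx => (hf x).hasDerivWithinAt)
      (fun x hx => hb x hx) (left_mem_Icc.2 zero_le_one) hr
    rw [Real.norm_eq_abs, Real.norm_eq_abs, sub_zero, abs_of_nonneg hr.1] at this
    exact this.trans (by nlinarith [hr.2])
  have a2 := key g2 g3 h2 (fun r _ => hK r)
  have a1 := key (fun r => g1 r - r * g2 0) (fun r => g2 r - 1 * g2 0)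
    (fun r => (h1 r).sub ((hasDerivAt_id r).mul_const _)) (by
      intro r hr; simpa using a2 r hr)
  have a0 := key (fun r => g r - r * g1 0 - r ^ 2 * (g2 0 / 2))
    (fun r => g1 r - 1 * g1 0 - (2 * r) * (g2 0 / 2))
    (fun r => ((h0 r).sub ((hasDerivAt_id r).mul_const _)).sub
      (by simpa using ((hasDerivAt_pow 2 r).mul_const (g2 0 / 2)))) (by
      intro r hr
      have := a1 r hr
      convert this using 2; ring)
  have := a0 1 ⟨zero_le_one, le_rfl⟩
  convert this using 2; ring

/-- A smooth test function. -/
lemma exists_test : ∃ (h h1 h2 h3 : ℝ → ℝ) (K : ℝ), 0 ≤ K ∧ (∀ r, HasDerivAt h (h1 r) r) ∧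
    (∀ r, HasDerivAt h1 (h2 r) r) ∧ (∀ r, HasDerivAt h2 (h3 r) r) ∧ (∀ r, |h1 r| ≤ K) ∧
    (∀ r, |h2 r| ≤ K) ∧ (∀ r, |h3 r| ≤ K) ∧ (∀ r, 0 ≤ h1 r) ∧ (∀ r, r ≤ 0 → h r = 0) ∧
    (∀ r, 0 ≤ h r) ∧ (∀ r, 0 < r → 0 < h r) := by
  have hc : ContDiff ℝ 4 Real.smoothTransition := Real.smoothTransition.contDiff (n := 4)
  have hd : ∀ k : ℕ, k < 4 → ∀ r, HasDerivAt (iteratedDeriv k Real.smoothTransition)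
      (iteratedDeriv (k+1) Real.smoothTransition r) r := by
    intro k hk r
    rw [iteratedDeriv_succ]
    exact (hc.differentiable_iteratedDeriv k (by exact_mod_cast hk) r).hasDerivAt
  have hcs : HasCompactSupport (deriv Real.smoothTransition) := by
    apply HasCompactSupport.intro (isCompact_Icc (a := (0:ℝ)) (b := 1))
    intro x hx
    rw [mem_Icc, not_and_or, not_le, not_le] at hx
    rcases hx with hx | hx
    · have : Real.smoothTransition =ᶠ[nhds x] fun _ => 0 := by
        filter_upwards [Iio_mem_nhds hx] with y hy
        exact Real.smoothTransition.zero_of_nonpos (le_of_lt hy)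
      rw [this.deriv_eq]; simp
    · have : Real.smoothTransition =ᶠ[nhds x] fun _ => 1 := by
        filter_upwards [Ioi_mem_nhds hx] with y hy
        exact Real.smoothTransition.one_of_one_le (le_of_lt hy)
      rw [this.deriv_eq]; simp
  have hcs2 : HasCompactSupport (deriv (deriv Real.smoothTransition)) := hcs.deriv
  have hcs3 : HasCompactSupport (deriv (deriv (deriv Real.smoothTransition))) := hcs2.deriv
  have e1 : iteratedDeriv 1 Real.smoothTransition = deriv Real.smoothTransition := iteratedDeriv_one
  have e2 : iteratedDeriv 2 Real.smoothTransition = deriv (deriv Real.smoothTransition) := by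
    rw [iteratedDeriv_succ, e1]
  have e3 : iteratedDeriv 3 Real.smoothTransition =
      deriv (deriv (deriv Real.smoothTransition)) := by
    rw [iteratedDeriv_succ, e2]
  have hcont : ∀ k : ℕ, k < 4 → Continuous (iteratedDeriv k Real.smoothTransition) :=
    fun k hk => continuous_iff_continuousAt.2 fun r => (hd k hk r).continuousAt
  obtain ⟨K1, hK1⟩ := hcs.exists_bound_of_continuous (e1 ▸ hcont 1 (by norm_num))
  obtain ⟨K2, hK2⟩ := hcs2.exists_bound_of_continuous (e2 ▸ hcont 2 (by norm_num))
  obtain ⟨K3, hK3⟩ := hcs3.exists_bound_of_continuous (e3 ▸ hcont 3 (by norm_num))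
  refine ⟨Real.smoothTransition, iteratedDeriv 1 Real.smoothTransition,
    iteratedDeriv 2 Real.smoothTransition, iteratedDeriv 3 Real.smoothTransition,
    max K1 (max K2 K3), ?_, ?_, hd 1 (by norm_num), hd 2 (by norm_num), ?_, ?_, ?_, ?_,
    fun r => Real.smoothTransition.zero_of_nonpos, Real.smoothTransition.nonneg,
    fun r => Real.smoothTransition.pos_of_pos⟩
  · exact le_max_of_le_left ((norm_nonneg _).trans (hK1 0))
  · intro r; simpa using hd 0 (by norm_num) r
  · intro r; rw [e1]; exact le_max_of_le_left (hK1 r)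
  · intro r; rw [e2]; exact le_max_of_le_right (le_max_of_le_left (hK2 r))
  · intro r; rw [e3]; exact le_max_of_le_right (le_max_of_le_right (hK3 r))
  · intro r; rw [e1]; exact Real.smoothTransition.monotone.deriv_nonneg

lemma taylorF {ι : Type*} [Fintype ι] (h h1 h2 h3 : ℝ → ℝ) (K : ℝ) (hK0 : 0 ≤ K)
    (d0 : ∀ r, HasDerivAt h (h1 r) r)
    (d1 : ∀ r, HasDerivAt h1 (h2 r) r) (d2 : ∀ r, HasDerivAt h2 (h3 r) r)
    (b1 : ∀ r, |h1 r| ≤ K) (b2 : ∀ r, |h2 r| ≤ K) (b3 : ∀ r, |h3 r| ≤ K)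
    (hnn : ∀ r, 0 ≤ h r) (w u : ι → ℝ) :
    |Real.exp (-∑ a, h (w a + u a)) - Real.exp (-∑ a, h (w a)) *
      (1 - ∑ a, h1 (w a) * u a + ((∑ a, h1 (w a) * u a) ^ 2 - ∑ a, h2 (w a) * u a ^ 2) / 2)| ≤
    ((Fintype.card ι * K) + 3 * (Fintype.card ι * K) ^ 2 + (Fintype.card ι * K) ^ 3) * ‖u‖ ^ 3 := by
  set N : ℝ := Fintype.card ι * K with hN
  have hN0 : 0 ≤ N := by positivity
  set H : ℝ → ℝ := fun r => ∑ a, h (w a + r * u a)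
  set H1 : ℝ → ℝ := fun r => ∑ a, h1 (w a + r * u a) * u a
  set H2 : ℝ → ℝ := fun r => ∑ a, h2 (w a + r * u a) * u a ^ 2
  set H3 : ℝ → ℝ := fun r => ∑ a, h3 (w a + r * u a) * u a ^ 3
  have lin : ∀ a r, HasDerivAt (fun r => w a + r * u a) (u a) r := by
    intro a r
    simpa using ((hasDerivAt_id r).mul_const (u a)).const_add (w a)
  have D0 : ∀ r, HasDerivAt H (H1 r) r := fun r => by
    refine HasDerivAt.fun_sum fun a _ => ?_
    exact (d0 _).comp r (lin a r)
  have D1 : ∀ r, HasDerivAt H1 (H2 r) r := fun r => by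
    refine HasDerivAt.fun_sum fun a _ => ?_
    exact (((d1 _).comp r (lin a r)).mul_const (u a)).congr_deriv (by ring)
  have D2 : ∀ r, HasDerivAt H2 (H3 r) r := fun r => by
    refine HasDerivAt.fun_sum fun a _ => ?_
    exact (((d2 _).comp r (lin a r)).mul_const (u a ^ 2)).congr_deriv (by ring)
  have bd : ∀ (f : ℝ → ℝ) (j : ℕ), (∀ r, |f r| ≤ K) → ∀ r,
      |∑ a, f (w a + r * u a) * u a ^ j| ≤ N * ‖u‖ ^ j := by
    intro f j hf r
    refine (Finset.abs_sum_le_sum_abs _ _).trans ?_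
    calc ∑ a, |f (w a + r * u a) * u a ^ j| ≤ ∑ a : ι, K * ‖u‖ ^ j := by
          refine Finset.sum_le_sum fun a _ => ?_
          rw [abs_mul, abs_pow]
          gcongr
          · exact hf _
          · exact norm_le_pi_norm u a
      _ = N * ‖u‖ ^ j := by simp [hN, mul_assoc]
  have B1 : ∀ r, |H1 r| ≤ N * ‖u‖ := fun r => by simpa using bd h1 1 b1 r
  have B2 : ∀ r, |H2 r| ≤ N * ‖u‖ ^ 2 := fun r => bd h2 2 b2 r
  have B3 : ∀ r, |H3 r| ≤ N * ‖u‖ ^ 3 := fun r => bd h3 3 b3 r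
  have E : ∀ r, HasDerivAt (fun r => Real.exp (-H r)) (Real.exp (-H r) * (-H1 r)) r :=
    fun r => (D0 r).neg.exp
  have key := taylor3 (fun r => Real.exp (-H r)) (fun r => Real.exp (-H r) * (-H1 r))
    (fun r => Real.exp (-H r) * (H1 r ^ 2 - H2 r))
    (fun r => Real.exp (-H r) * (- H1 r ^ 3 + 3 * H1 r * H2 r - H3 r))
    ((N + 3 * N ^ 2 + N ^ 3) * ‖u‖ ^ 3) E
    (fun r => ((E r).mul (D1 r).neg).congr_deriv (by simp; ring))
    (fun r => 
      ((E r).mul (((D1 r).pow 2).sub (D2 r))).congr_deriv (by simp; ring)) (by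
    intro r
    have he : Real.exp (-H r) ≤ 1 := by
      rw [Real.exp_le_one_iff, neg_nonpos]
      exact Finset.sum_nonneg fun a _ => hnn _
    rw [abs_mul, abs_of_pos (Real.exp_pos _)]
    refine (mul_le_of_le_one_left (abs_nonneg _) he).trans ?_
    have t1 : |H1 r| ^ 3 ≤ (N * ‖u‖) ^ 3 := by gcongr; exact B1 r
    have t2 : |H1 r| * |H2 r| ≤ (N * ‖u‖) * (N * ‖u‖ ^ 2) :=
      mul_le_mul (B1 r) (B2 r) (abs_nonneg _) (by positivity)
    calc |- H1 r ^ 3 + 3 * H1 r * H2 r - H3 r| ≤ |- H1 r ^ 3 + 3 * H1 r * H2 r| + |H3 r| :=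
          abs_sub _ _
      _ ≤ |- H1 r ^ 3| + |3 * H1 r * H2 r| + |H3 r| := by gcongr; exact abs_add_le _ _
      _ = |H1 r| ^ 3 + 3 * (|H1 r| * |H2 r|) + |H3 r| := by
          rw [abs_neg, abs_pow, abs_mul, abs_mul]; norm_num; ring
      _ ≤ (N * ‖u‖) ^ 3 + 3 * ((N * ‖u‖) * (N * ‖u‖ ^ 2)) + N * ‖u‖ ^ 3 := by
          have := B3 r; gcongr
      _ = _ := by ring)
  convert key using 2
  simp [H, H1, H2]
  ring


lemma gauss_memLp_eval {ι : Type*} [Fintype ι] (P : Measure (ι → ℝ)) [IsGaussian P] (a : ι)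
    (p : ENNReal) (hp : p ≠ ⊤) : MemLp (fun x : ι → ℝ => x a) p P :=
  IsGaussian.memLp_dual P (ContinuousLinearMap.proj a) p hp

lemma gauss_int_mul {ι : Type*} [Fintype ι] (P : Measure (ι → ℝ)) [IsGaussian P] (a b : ι) :
    Integrable (fun x : ι → ℝ => x a * x b) P :=
  (gauss_memLp_eval P a 2 (by simp)).integrable_mul (gauss_memLp_eval P b 2 (by simp))

lemma gauss_int_eval {ι : Type*} [Fintype ι] (P : Measure (ι → ℝ)) [IsGaussian P] (a : ι) :
    Integrable (fun x : ι → ℝ => x a) P :=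
  memLp_one_iff_integrable.1 (gauss_memLp_eval P a 1 (by simp))

lemma gauss_int_norm3 {ι : Type*} [Fintype ι] (P : Measure (ι → ℝ)) [IsGaussian P] :
    Integrable (fun x : ι → ℝ => ‖x‖ ^ 3) P := by
  have := (IsGaussian.memLp_id P 3 (by simp)).integrable_norm_pow (by norm_num)
  simpa using this

lemma expandF {ι : Type*} [Fintype ι] (h h1 h2 h3 : ℝ → ℝ) (K : ℝ) (hK0 : 0 ≤ K)
    (d0 : ∀ r, HasDerivAt h (h1 r) r)
    (d1 : ∀ r, HasDerivAt h1 (h2 r) r) (d2 : ∀ r, HasDerivAt h2 (h3 r) r)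
    (b1 : ∀ r, |h1 r| ≤ K) (b2 : ∀ r, |h2 r| ≤ K) (b3 : ∀ r, |h3 r| ≤ K)
    (hnn : ∀ r, 0 ≤ h r) (P : Measure (ι → ℝ)) [IsGaussian P] (hP0 : ∀ a, ∫ x, x a ∂P = 0)
    (w : ι → ℝ) (δ : ℝ) (hδ : 0 ≤ δ) :
    |∫ x, Real.exp (-∑ a, h (w a + δ * x a)) ∂P - Real.exp (-∑ a, h (w a)) *
      (1 + δ ^ 2 / 2 * (∑ a, ∑ b, h1 (w a) * h1 (w b) * ∫ x, x a * x b ∂P -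
        ∑ a, h2 (w a) * ∫ x, x a * x a ∂P))| ≤
    ((Fintype.card ι * K) + 3 * (Fintype.card ι * K) ^ 2 + (Fintype.card ι * K) ^ 3) *
      (∫ x, ‖x‖ ^ 3 ∂P) * δ ^ 3 := by
  set C := ((Fintype.card ι * K) + 3 * (Fintype.card ι * K) ^ 2 + (Fintype.card ι * K) ^ 3)
  set F0 := Real.exp (-∑ a, h (w a))
  have hcont : Continuous h := continuous_iff_continuousAt.2 fun r => (d0 r).continuousAt
  have iF : Integrable (fun x : ι → ℝ => Real.exp (-∑ a, h (w a + δ * x a))) P := by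
    refine Integrable.of_bound (C := 1) ?_ (Eventually.of_forall fun x => ?_)
    · exact Continuous.aestronglyMeasurable (by fun_prop)
    · rw [Real.norm_eq_abs, abs_of_pos (Real.exp_pos _), Real.exp_le_one_iff, neg_nonpos]
      exact Finset.sum_nonneg fun a _ => hnn _
  have i1 : Integrable (fun x : ι → ℝ => ∑ a, h1 (w a) * (δ * x a)) P :=
    integrable_finsetSum _ fun a _ => ((gauss_int_eval P a).const_mul δ).const_mul _
  have i2 : Integrable (fun x : ι → ℝ => ∑ a, ∑ b, h1 (w a) * h1 (w b) * (x a * x b)) P :=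
    integrable_finsetSum _ fun a _ => integrable_finsetSum _ fun b _ =>
      (gauss_int_mul P a b).const_mul _
  have i3 : Integrable (fun x : ι → ℝ => ∑ a, h2 (w a) * (x a * x a)) P :=
    integrable_finsetSum _ fun a _ => (gauss_int_mul P a a).const_mul _
  set T : (ι → ℝ) → ℝ := fun x => F0 * (1 - ∑ a, h1 (w a) * (δ * x a) + δ ^ 2 / 2 *
    (∑ a, ∑ b, h1 (w a) * h1 (w b) * (x a * x b) - ∑ a, h2 (w a) * (x a * x a))) with hT
  have iT : Integrable T P :=
    (((integrable_const _).sub i1).add ((i2.sub i3).const_mul _)).const_mul _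
  have eT : ∫ x, T x ∂P = F0 * (1 + δ ^ 2 / 2 * (∑ a, ∑ b, h1 (w a) * h1 (w b) *
      ∫ x, x a * x b ∂P - ∑ a, h2 (w a) * ∫ x, x a * x a ∂P)) := by
    have i4 : Integrable (fun x : ι → ℝ => 1 - ∑ a, h1 (w a) * (δ * x a)) P :=
      (integrable_const _).sub i1
    have i5 : Integrable (fun x : ι → ℝ => δ ^ 2 / 2 * (∑ a, ∑ b, h1 (w a) * h1 (w b) *
      (x a * x b) - ∑ a, h2 (w a) * (x a * x a))) P := (i2.sub i3).const_mul _
    rw [hT, integral_const_mul, integral_add i4 i5, integral_sub (integrable_const _) i1, integral_const_mul,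
      integral_sub i2 i3, integral_finsetSum, integral_finsetSum, integral_finsetSum]
    · simp_rw [integral_const_mul, hP0]
      have : ∀ a, ∫ x : ι → ℝ, ∑ b, h1 (w a) * h1 (w b) * (x a * x b) ∂P =
          ∑ b, h1 (w a) * h1 (w b) * ∫ x : ι → ℝ, x a * x b ∂P := fun a => by
        rw [integral_finsetSum]
        · simp_rw [integral_const_mul]
        · exact fun b _ => (gauss_int_mul P a b).const_mul _
      simp_rw [this]
      simp
    · exact fun a _ => (gauss_int_mul P a a).const_mul _
    · exact fun a _ => integrable_finsetSum _ fun b _ => (gauss_int_mul P a b).const_mul _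
    · exact fun a _ => ((gauss_int_eval P a).const_mul δ).const_mul _
  rw [← eT, ← integral_sub iF iT]
  calc |∫ x, (Real.exp (-∑ a, h (w a + δ * x a)) - T x) ∂P|
      ≤ ∫ x, |Real.exp (-∑ a, h (w a + δ * x a)) - T x| ∂P := abs_integral_le_integral_abs
    _ ≤ ∫ x, C * δ ^ 3 * ‖x‖ ^ 3 ∂P := by
        refine integral_mono (iF.sub iT).abs ((gauss_int_norm3 P).const_mul _) fun x => ?_
        have := taylorF h h1 h2 h3 K hK0 d0 d1 d2 b1 b2 b3 hnn w (δ • x)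
        rw [norm_smul, Real.norm_eq_abs, abs_of_nonneg hδ] at this
        simp only [Pi.smul_apply, smul_eq_mul] at this
        have e1 : (∑ a, h1 (w a) * (δ * x a)) ^ 2 =
            δ ^ 2 * ∑ a, ∑ b, h1 (w a) * h1 (w b) * (x a * x b) := by
          rw [sq, Finset.sum_mul_sum, Finset.mul_sum]
          refine Finset.sum_congr rfl fun a _ => ?_
          rw [Finset.mul_sum]
          exact Finset.sum_congr rfl fun b _ => by ring
        have e2 : ∑ a, h2 (w a) * (δ * x a) ^ 2 = δ ^ 2 * ∑ a, h2 (w a) * (x a * x a) := by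
          rw [Finset.mul_sum]
          exact Finset.sum_congr rfl fun b _ => by ring
        have hTx : T x = Real.exp (-∑ a, h (w a)) * (1 - ∑ a, h1 (w a) * (δ * x a) +
            ((∑ a, h1 (w a) * (δ * x a)) ^ 2 - ∑ a, h2 (w a) * (δ * x a) ^ 2) / 2) := by
          rw [e1, e2, hT]; ring
        rw [← hTx] at this
        exact this.trans_eq (by simp only [C]; ring)
    _ = C * (∫ x, ‖x‖ ^ 3 ∂P) * δ ^ 3 := by rw [integral_const_mul]; ring

lemma stepF {ι : Type*} [Fintype ι] (h h1 h2 h3 : ℝ → ℝ) (K : ℝ) (hK0 : 0 ≤ K)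
    (d0 : ∀ r, HasDerivAt h (h1 r) r)
    (d1 : ∀ r, HasDerivAt h1 (h2 r) r) (d2 : ∀ r, HasDerivAt h2 (h3 r) r)
    (b1 : ∀ r, |h1 r| ≤ K) (b2 : ∀ r, |h2 r| ≤ K) (b3 : ∀ r, |h3 r| ≤ K)
    (hnn : ∀ r, 0 ≤ h r) (hnn1 : ∀ r, 0 ≤ h1 r)
    (P Q : Measure (ι → ℝ)) [IsGaussian P] [IsGaussian Q] (hP0 : ∀ a, ∫ x, x a ∂P = 0)
    (hQ0 : ∀ a, ∫ x, x a ∂Q = 0) (hd : ∀ a, ∫ x, x a * x a ∂P = ∫ x, x a * x a ∂Q)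
    (hle : ∀ a b, ∫ x, x a * x b ∂P ≤ ∫ x, x a * x b ∂Q) :
    ∃ C : ℝ, ∀ (w : ι → ℝ) (δ : ℝ), 0 ≤ δ →
    ∫ x, Real.exp (-∑ a, h (w a + δ * x a)) ∂P ≤
      ∫ x, Real.exp (-∑ a, h (w a + δ * x a)) ∂Q + C * δ ^ 3 := by
  refine ⟨((Fintype.card ι * K) + 3 * (Fintype.card ι * K) ^ 2 + (Fintype.card ι * K) ^ 3) *
      (∫ x, ‖x‖ ^ 3 ∂P) + ((Fintype.card ι * K) + 3 * (Fintype.card ι * K) ^ 2 +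
      (Fintype.card ι * K) ^ 3) * (∫ x, ‖x‖ ^ 3 ∂Q), fun w δ hδ => ?_⟩
  have eP := (abs_le.1 (expandF h h1 h2 h3 K hK0 d0 d1 d2 b1 b2 b3 hnn P hP0 w δ hδ)).2
  have eQ := (abs_le.1 (expandF h h1 h2 h3 K hK0 d0 d1 d2 b1 b2 b3 hnn Q hQ0 w δ hδ)).1
  have hm : Real.exp (-∑ a, h (w a)) *
      (1 + δ ^ 2 / 2 * (∑ a, ∑ b, h1 (w a) * h1 (w b) * ∫ x, x a * x b ∂P -
        ∑ a, h2 (w a) * ∫ x, x a * x a ∂P)) ≤ Real.exp (-∑ a, h (w a)) *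
      (1 + δ ^ 2 / 2 * (∑ a, ∑ b, h1 (w a) * h1 (w b) * ∫ x, x a * x b ∂Q -
        ∑ a, h2 (w a) * ∫ x, x a * x a ∂Q)) := by
    simp_rw [hd]
    have : ∑ a, ∑ b, h1 (w a) * h1 (w b) * ∫ x, x a * x b ∂P ≤
        ∑ a, ∑ b, h1 (w a) * h1 (w b) * ∫ x, x a * x b ∂Q :=
      Finset.sum_le_sum fun a _ => Finset.sum_le_sum fun b _ =>
        mul_le_mul_of_nonneg_left (hle a b) (mul_nonneg (hnn1 _) (hnn1 _))
    refine mul_le_mul_of_nonneg_left ?_ (Real.exp_pos _).le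
    have h2 : 0 ≤ δ ^ 2 / 2 := by positivity
    nlinarith [mul_le_mul_of_nonneg_left this h2]
  linarith

lemma gauss_stable {ι : Type*} [Fintype ι] (P : Measure (ι → ℝ)) [IsGaussian P]
    (hP0 : ∀ a, ∫ x, x a ∂P = 0) (a b c : ℝ) (habc : a ^ 2 + b ^ 2 = c ^ 2) :
    (P.prod P).map (fun p => a • p.1 + b • p.2) = P.map (fun x => c • x) := by
  have hL : ∀ L : StrongDual ℝ (ι → ℝ), P[L] = 0 := by
    intro L
    classical
    have : ∀ x : ι → ℝ, L x = ∑ i, x i * L (Pi.single i 1) := by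
      intro x
      conv_lhs => rw [← Finset.univ_sum_single x]
      rw [map_sum]
      refine Finset.sum_congr rfl fun i _ => ?_
      rw [← smul_eq_mul, ← map_smul, ← Pi.single_smul]; simp
    rw [integral_congr_ae (Eventually.of_forall this)]
    rw [integral_finsetSum _ (fun i _ => (gauss_int_eval P i).mul_const _)]
    simp_rw [integral_mul_const, hP0]
    simp
  let T : (ι → ℝ) × (ι → ℝ) →L[ℝ] (ι → ℝ) :=
    a • ContinuousLinearMap.fst ℝ _ _ + b • ContinuousLinearMap.snd ℝ _ _
  let S : (ι → ℝ) →L[ℝ] (ι → ℝ) := c • ContinuousLinearMap.id ℝ _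
  have hT : (fun p : (ι → ℝ) × (ι → ℝ) => a • p.1 + b • p.2) = T := by ext p; simp [T]
  have hS : (fun p : (ι → ℝ) => c • p) = S := by ext p; simp [S]
  rw [hT, hS]
  refine Measure.ext_of_charFunDual ?_
  ext L
  have e1 : (L.comp T).comp (.inl ℝ _ _) = a • L := by ext x; simp [T]
  have e2 : (L.comp T).comp (.inr ℝ _ _) = b • L := by ext x; simp [T]
  have e3 : L.comp S = c • L := by ext x; simp [S]
  rw [charFunDual_map, charFunDual_prod, charFunDual_map, e1, e2, e3]
  simp_rw [IsGaussian.charFunDual_eq_of_forall_strongDual_eq_zero hL]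
  rw [← Complex.exp_add, FunLike.coe_smul, FunLike.coe_smul, FunLike.coe_smul,
    variance_smul, variance_smul, variance_smul, ← habc]
  push_cast
  ring_nf


lemma int_bdd_cont {E : Type*} [TopologicalSpace E] [MeasurableSpace E] [OpensMeasurableSpace E]
    (P : Measure E) [IsProbabilityMeasure P]
    (f : E → ℝ) (hf : Continuous f) (hb : ∀ x, ‖f x‖ ≤ 1) : Integrable f P :=
  Integrable.of_bound hf.measurable.aestronglyMeasurable 1 (Eventually.of_forall hb)

lemma stable_integral {ι : Type*} [Fintype ι] (P : Measure (ι → ℝ)) [IsGaussian P]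
    (hP0 : ∀ a, ∫ x, x a ∂P = 0) (a b c : ℝ) (habc : a ^ 2 + b ^ 2 = c ^ 2)
    (f : (ι → ℝ) → ℝ) (hf : Continuous f) (hb : ∀ x, ‖f x‖ ≤ 1) :
    ∫ x, f (c • x) ∂P = ∫ x, ∫ x', f (a • x + b • x') ∂P ∂P := by
  have h := gauss_stable P hP0 a b c habc
  have h1 : ∫ x, f x ∂(P.map (fun x => c • x)) = ∫ x, f (c • x) ∂P :=
    integral_map (Measurable.aemeasurable (by fun_prop)) hf.measurable.aestronglyMeasurable
  have h2 : ∫ x, f x ∂((P.prod P).map (fun p => a • p.1 + b • p.2)) =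
      ∫ p, f (a • p.1 + b • p.2) ∂(P.prod P) :=
    integral_map (Measurable.aemeasurable (by fun_prop)) hf.measurable.aestronglyMeasurable
  rw [← h1, ← h, h2]
  exact integral_prod (fun p : (ι → ℝ) × (ι → ℝ) => f (a • p.1 + b • p.2))
    (int_bdd_cont _ _ (by fun_prop) (fun _ => hb _))

/-- If one small step is favourable up to `C δ^3`, the Gaussian expectations are comparable. -/
lemma lindeberg {ι : Type*} [Fintype ι]
    (P Q : Measure (ι → ℝ)) [IsGaussian P] [IsGaussian Q] (hP0 : ∀ a, ∫ x, x a ∂P = 0)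
    (hQ0 : ∀ a, ∫ x, x a ∂Q = 0) (f : (ι → ℝ) → ℝ) (hf : Continuous f) (hb : ∀ x, ‖f x‖ ≤ 1)
    (C : ℝ) (hstep : ∀ (w : ι → ℝ) (δ : ℝ), 0 ≤ δ →
      ∫ x, f (w + δ • x) ∂P ≤ ∫ x, f (w + δ • x) ∂Q + C * δ ^ 3) :
    ∫ x, f x ∂P ≤ ∫ x, f x ∂Q := by
  have main : ∀ n : ℕ, 0 < n → ∫ x, f x ∂P ≤ ∫ x, f x ∂Q + C * (Real.sqrt (1 / n)) := by
    intro n hn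
    have hn' : (0:ℝ) < n := by exact_mod_cast hn
    set δ := Real.sqrt (1 / n) with hδ
    have hδ0 : 0 ≤ δ := Real.sqrt_nonneg _
    have hδ2 : δ ^ 2 = 1 / n := Real.sq_sqrt (by positivity)
    have cont_int : ∀ (ν : Measure (ι → ℝ)) [IsProbabilityMeasure ν] (a b : ℝ),
        Continuous fun x => ∫ y, f (a • x + b • y) ∂ν := by
      intro ν _ a b
      refine continuous_of_dominated (bound := fun _ => 1) ?_ ?_ (integrable_const _) ?_
      · exact fun x => Continuous.aestronglyMeasurable (by fun_prop)
      · exact fun x => Eventually.of_forall fun y => hb _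
      · exact Eventually.of_forall fun y => by fun_prop
    have cont_int' : ∀ (ν : Measure (ι → ℝ)) [IsProbabilityMeasure ν] (a : ℝ),
        Continuous fun w => ∫ y, f (w + a • y) ∂ν := by
      intro ν _ a
      simpa using cont_int ν 1 a
    have norm_int : ∀ (ν : Measure (ι → ℝ)) [IsProbabilityMeasure ν] (g : (ι → ℝ) → ℝ),
        (∀ y, ‖g y‖ ≤ 1) → ‖∫ y, g y ∂ν‖ ≤ 1 := by
      intro ν _ g hg
      have := norm_integral_le_of_norm_le_const (μ := ν) (Eventually.of_forall hg)
      simpa using this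
    set Ψ : ℕ → ℝ := fun k => ∫ x, ∫ y, f (Real.sqrt (k / n) • x + Real.sqrt ((n - k) / n) • y) ∂Q ∂P
      with hΨ
    have step : ∀ k < n, Ψ (k + 1) ≤ Ψ k + C * δ ^ 3 := by
      intro k hk
      have hk' : (k:ℝ) + 1 ≤ n := by exact_mod_cast hk
      set a := Real.sqrt (k / n) with ha
      set a' := Real.sqrt (((k + 1 : ℕ) : ℝ) / n) with ha'
      set b := Real.sqrt ((n - k) / n) with hbb
      set b' := Real.sqrt ((n - (k + 1 : ℕ)) / n) with hbb'
      have ha2 : a ^ 2 + δ ^ 2 = a' ^ 2 := by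
        rw [hδ2, ha, ha', Real.sq_sqrt (by positivity), Real.sq_sqrt (by positivity)]
        push_cast; ring
      have hb2 : b' ^ 2 + δ ^ 2 = b ^ 2 := by
        rw [hδ2, hbb, hbb', Real.sq_sqrt, Real.sq_sqrt]
        · push_cast; ring
        · exact div_nonneg (by linarith) hn'.le
        · push_cast; exact div_nonneg (by linarith) hn'.le
      have cj : Continuous fun p : (ι → ℝ) × (ι → ℝ) => f (a' • p.1 + b' • p.2) := by fun_prop
      calc Ψ (k + 1) = ∫ y, ∫ x, f (a' • x + b' • y) ∂P ∂Q := by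
            rw [hΨ]
            exact integral_integral_swap (int_bdd_cont _ _ cj fun _ => hb _)
        _ = ∫ y, ∫ x, ∫ x', f (a • x + b' • y + δ • x') ∂P ∂P ∂Q := by
            congr 1; ext y
            rw [stable_integral P hP0 a δ a' ha2 (fun z => f (z + b' • y)) (by fun_prop)
              (fun _ => hb _)]
            congr 1; ext x; congr 1; ext x'; congr 1; abel
        _ ≤ ∫ y, ∫ x, (∫ y', f (a • x + b' • y + δ • y') ∂Q + C * δ ^ 3) ∂P ∂Q := by
            have c1 : Continuous fun p : (ι → ℝ) × (ι → ℝ) =>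
                ∫ x', f (a • p.2 + b' • p.1 + δ • x') ∂P :=
              (cont_int' P δ).comp (by fun_prop)
            have c2 : Continuous fun p : (ι → ℝ) × (ι → ℝ) =>
                ∫ x', f (a • p.2 + b' • p.1 + δ • x') ∂Q :=
              (cont_int' Q δ).comp (by fun_prop)
            have j1 := (int_bdd_cont (Q.prod P) _ c1 fun _ => norm_int _ _ fun _ => hb _)
            have j2 := (int_bdd_cont (Q.prod P) _ c2 fun _ => norm_int _ _ fun _ => hb _).add
              (integrable_const (C * δ ^ 3))
            refine integral_mono j1.integral_prod_left j2.integral_prod_left fun y => ?_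
            refine integral_mono (int_bdd_cont P _ (c1.comp (Continuous.prodMk_right y))
              fun _ => norm_int _ _ fun _ => hb _)
              ((int_bdd_cont P _ (c2.comp (Continuous.prodMk_right y))
              fun _ => norm_int _ _ fun _ => hb _).add (integrable_const (C * δ ^ 3))) fun x => ?_
            exact hstep _ _ hδ0
        _ = ∫ y, ∫ x, ∫ y', f (a • x + b' • y + δ • y') ∂Q ∂P ∂Q + C * δ ^ 3 := by
            have c2 : Continuous fun p : (ι → ℝ) × (ι → ℝ) =>
                ∫ x', f (a • p.2 + b' • p.1 + δ • x') ∂Q :=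
              (cont_int' Q δ).comp (by fun_prop)
            have j1 := (int_bdd_cont (Q.prod P) _ c2 fun _ => norm_int _ _ fun _ => hb _)
            have e : ∀ y, ∫ x, (∫ y', f (a • x + b' • y + δ • y') ∂Q + C * δ ^ 3) ∂P =
                ∫ x, ∫ y', f (a • x + b' • y + δ • y') ∂Q ∂P + C * δ ^ 3 := by
              intro y
              have ii : Integrable (fun x => ∫ y', f (a • x + b' • y + δ • y') ∂Q) P :=
                int_bdd_cont P _ (c2.comp (Continuous.prodMk_right y))
                  fun _ => norm_int _ _ fun _ => hb _
              rw [integral_add ii (integrable_const _)]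
              simp
            simp_rw [e]
            rw [integral_add j1.integral_prod_left (integrable_const _)]
            simp
        _ = ∫ x, ∫ y, ∫ y', f (a • x + b' • y + δ • y') ∂Q ∂Q ∂P + C * δ ^ 3 := by
            have c2 : Continuous fun p : (ι → ℝ) × (ι → ℝ) =>
                ∫ x', f (a • p.2 + b' • p.1 + δ • x') ∂Q :=
              (cont_int' Q δ).comp (by fun_prop)
            have j1 := (int_bdd_cont (Q.prod P) _ c2 fun _ => norm_int _ _ fun _ => hb _)
            rw [integral_integral_swap j1]
        _ = Ψ k + C * δ ^ 3 := by
            rw [hΨ]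
            congr 1; congr 1; ext x
            rw [stable_integral Q hQ0 b' δ b hb2 (fun z => f (a • x + z)) (by fun_prop)
              (fun _ => hb _)]
            congr 1; ext y; congr 1; ext y'; congr 1; abel
    have tele : ∀ k ≤ n, Ψ k ≤ Ψ 0 + k * (C * δ ^ 3) := by
      intro k
      induction k with
      | zero => intro _; simp
      | succ k ih =>
        intro hk
        have := ih (by omega)
        have := step k (by omega)
        push_cast; linarith
    have h0 : Ψ 0 = ∫ x, f x ∂Q := by
      simp [hΨ, hn'.ne']
    have h1 : Ψ n = ∫ x, f x ∂P := by
      simp [hΨ, hn'.ne']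
    have := tele n le_rfl
    rw [h0, h1] at this
    refine this.trans_eq ?_
    have : (n:ℝ) * δ ^ 2 = 1 := by rw [hδ2]; field_simp
    linear_combination C * δ * this
  have hlim : Tendsto (fun n : ℕ => ∫ x, f x ∂Q + C * Real.sqrt (1 / n)) atTop
      (nhds (∫ x, f x ∂Q + C * Real.sqrt 0)) :=
    (((Real.continuous_sqrt.tendsto 0).comp tendsto_one_div_atTop_nhds_zero_nat).const_mul
      C).const_add _
  rw [Real.sqrt_zero, mul_zero, add_zero] at hlim
  exact ge_of_tendsto hlim (eventually_atTop.2 ⟨1, fun n hn => main n hn⟩)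

/-- The Slepian inequality, for Gaussian measures on `ι → ℝ`. -/
lemma slepian_measure {ι : Type*} [Fintype ι]
    (P Q : Measure (ι → ℝ)) [IsGaussian P] [IsGaussian Q] (hP0 : ∀ a, ∫ x, x a ∂P = 0)
    (hQ0 : ∀ a, ∫ x, x a ∂Q = 0) (hd : ∀ a, ∫ x, x a * x a ∂P = ∫ x, x a * x a ∂Q)
    (hle : ∀ a b, ∫ x, x a * x b ∂P ≤ ∫ x, x a * x b ∂Q) (c : ℝ) :
    P.real {x | ∀ a, x a ≤ c} ≤ Q.real {x | ∀ a, x a ≤ c} := by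
  obtain ⟨h, h1, h2, h3, K, hK0, d0, d1, d2, b1, b2, b3, hm, hz, hnn, hpos⟩ := exists_test
  have hcont : Continuous h := continuous_iff_continuousAt.2 fun r => (d0 r).continuousAt
  have comp : ∀ n : ℕ, ∫ x, Real.exp (-∑ a, n * h (x a - c)) ∂P ≤
      ∫ x, Real.exp (-∑ a, n * h (x a - c)) ∂Q := by
    intro n
    have lin : ∀ r : ℝ, HasDerivAt (fun r => r - c) 1 r := fun r => (hasDerivAt_id r).sub_const c
    obtain ⟨C, hC⟩ := stepF (fun r => n * h (r - c)) (fun r => n * h1 (r - c))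
      (fun r => n * h2 (r - c)) (fun r => n * h3 (r - c)) (n * K) (by positivity)
      (fun r => (((d0 _).comp r (lin r)).const_mul (n:ℝ)).congr_deriv (by ring))
      (fun r => (((d1 _).comp r (lin r)).const_mul (n:ℝ)).congr_deriv (by ring))
      (fun r => (((d2 _).comp r (lin r)).const_mul (n:ℝ)).congr_deriv (by ring))
      (fun r => by rw [abs_mul, Nat.abs_cast]; exact mul_le_mul_of_nonneg_left (b1 _) (by positivity))
      (fun r => by rw [abs_mul, Nat.abs_cast]; exact mul_le_mul_of_nonneg_left (b2 _) (by positivity))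
      (fun r => by rw [abs_mul, Nat.abs_cast]; exact mul_le_mul_of_nonneg_left (b3 _) (by positivity))
      (fun r => mul_nonneg (by positivity) (hnn _)) (fun r => mul_nonneg (by positivity) (hm _))
      P Q hP0 hQ0 hd hle
    refine lindeberg P Q hP0 hQ0 (fun x => Real.exp (-∑ a, n * h (x a - c))) (by fun_prop) ?_ C hC
    intro x
    rw [Real.norm_eq_abs, abs_of_pos (Real.exp_pos _), Real.exp_le_one_iff, neg_nonpos]
    exact Finset.sum_nonneg fun a _ => mul_nonneg (by positivity) (hnn _)
  have lim : ∀ (ν : Measure (ι → ℝ)) [IsProbabilityMeasure ν],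
      Tendsto (fun n : ℕ => ∫ x, Real.exp (-∑ a, n * h (x a - c)) ∂ν) atTop
        (nhds (ν.real {x | ∀ a, x a ≤ c})) := by
    intro ν _
    have hms : MeasurableSet {x : ι → ℝ | ∀ a, x a ≤ c} := by
      have : {x : ι → ℝ | ∀ a, x a ≤ c} = ⋂ a, {x | x a ≤ c} := by ext; simp
      rw [this]
      exact MeasurableSet.iInter fun a => measurableSet_le (measurable_pi_apply a) measurable_const
    rw [← integral_indicator_one hms]
    refine tendsto_integral_of_dominated_convergence (fun _ => 1) ?_ (integrable_const _) ?_ ?_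
    · exact fun n => Continuous.aestronglyMeasurable (by fun_prop)
    · refine fun n => Eventually.of_forall fun x => ?_
      rw [Real.norm_eq_abs, abs_of_pos (Real.exp_pos _), Real.exp_le_one_iff, neg_nonpos]
      exact Finset.sum_nonneg fun a _ => mul_nonneg (by positivity) (hnn _)
    · refine Eventually.of_forall fun x => ?_
      simp_rw [← Finset.mul_sum]
      by_cases hx : ∀ a, x a ≤ c
      · have : ∑ a, h (x a - c) = 0 := Finset.sum_eq_zero fun a _ => hz _ (by linarith [hx a])
        have hx' : x ∈ {x : ι → ℝ | ∀ a, x a ≤ c} := hx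
        rw [Set.indicator_of_mem hx', this]
        simp
      · have hx' : x ∉ {x : ι → ℝ | ∀ a, x a ≤ c} := hx
        rw [Set.indicator_of_notMem hx']
        push Not at hx
        obtain ⟨a, ha⟩ := hx
        have : 0 < ∑ a, h (x a - c) :=
          Finset.sum_pos' (fun a _ => hnn _) ⟨a, Finset.mem_univ _, hpos _ (by linarith)⟩
        exact Real.tendsto_exp_neg_atTop_nhds_zero.comp
          (tendsto_natCast_atTop_atTop.atTop_mul_const this)
  exact le_of_tendsto_of_tendsto' (lim P) (lim Q) comp


lemma pi_isGaussian {ι J : Type*} [Fintype ι] [Fintype J] (P : Measure (ι → ℝ)) [IsGaussian P] :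
    IsGaussian (Measure.pi fun _ : J => P) := by
  have h1 : iIndepFun (fun (j : J) (x : J → ι → ℝ) => x j) (Measure.pi fun _ : J => P) :=
    iIndepFun_pi (X := fun _ x => x) (fun _ => aemeasurable_id)
  have h2 : ∀ j : J, HasGaussianLaw (fun x : J → ι → ℝ => x j) (Measure.pi fun _ : J => P) := by
    intro j
    refine ⟨?_⟩
    have := (measurePreserving_eval (fun _ : J => P) j).map_eq
    have e : (fun x : J → ι → ℝ => x j) = Function.eval j := rfl
    rw [e, this]
    infer_instance
  have h3 := (h1.hasGaussianLaw h2).isGaussian_map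
  have e : (fun (x : J → ι → ℝ) => fun j => x j) = id := rfl
  rw [e, Measure.map_id] at h3
  exact h3

lemma block_law {ι J : Type*} [Fintype ι] [Fintype J] [DecidableEq J]
    (P : Measure (ι → ℝ)) [IsGaussian P] (hP0 : ∀ a, ∫ x, x a ∂P = 0)
    (G : Measure (J → ℝ)) [IsGaussian G] (hG0 : ∀ a, ∫ x, x a ∂G = 0) (b : ι → J) (r : ℝ)
    (Q : Measure (ι → ℝ)) (hQ : Q = ((Measure.pi fun _ : J => P).prod G).map
      (fun p a => r * p.1 (b a) a + p.2 (b a))) :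
    IsGaussian Q ∧ (∀ a, ∫ x, x a ∂Q = 0) ∧ ∀ a a', ∫ x, x a * x a' ∂Q =
      r ^ 2 * (if b a = b a' then ∫ x, x a * x a' ∂P else 0) + ∫ x, x (b a) * x (b a') ∂G := by
  have hi : iIndepFun (fun (j : J) (x : J → ι → ℝ) => x j) (Measure.pi fun _ : J => P) :=
    iIndepFun_pi (X := fun _ x => x) (fun _ => aemeasurable_id)
  have mpe : ∀ j, MeasurePreserving (Function.eval j) (Measure.pi fun _ : J => P) P :=
    measurePreserving_eval (fun _ : J => P)
  have gp := pi_isGaussian (J := J) P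
  generalize (Measure.pi fun _ : J => P) = PP at *
  have hm : Measurable (fun (p : (J → ι → ℝ) × (J → ℝ)) (a : ι) => r * p.1 (b a) a + p.2 (b a)) := by
    fun_prop
  have i1 : ∀ (j : J) a, ∫ x, x j a ∂PP = 0 := by
    intro j a
    have h := integral_map (μ := PP) (φ := Function.eval j)
      (f := fun y : ι → ℝ => y a) (mpe j).aemeasurable
      (Measurable.aestronglyMeasurable (by fun_prop))
    rw [(mpe j).map_eq, hP0] at h
    exact h.symm
  have m1 : ∀ (j : J) a, MemLp (fun x : J → ι → ℝ => x j a) 2 PP :=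
    fun j a => (gauss_memLp_eval P a 2 (by simp)).comp_measurePreserving (mpe j)
  have m2 : ∀ (j : J), MemLp (fun x : J → ℝ => x j) 2 G := fun j => gauss_memLp_eval G j 2 (by simp)
  have i2 : ∀ (j j' : J) a a', ∫ x, x j a * x j' a' ∂PP =
      if j = j' then ∫ x, x a * x a' ∂P else 0 := by
    intro j j' a a'
    split_ifs with h
    · subst h
      have h := integral_map (μ := PP) (φ := Function.eval j)
        (f := fun y : ι → ℝ => y a * y a') (mpe j).aemeasurable
        (Measurable.aestronglyMeasurable (by fun_prop))
      rw [(mpe j).map_eq] at h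
      exact h.symm
    · have ma : Measurable (fun y : ι → ℝ => y a) := measurable_pi_apply _
      have ma' : Measurable (fun y : ι → ℝ => y a') := measurable_pi_apply _
      have := (hi.indepFun h).comp ma ma'
      have := this.integral_mul_eq_mul_integral (m1 j a).1 (m1 j' a').1
      have e := i1 j a
      simp only [Function.comp_def, Pi.mul_apply] at this
      rw [this, e, zero_mul]
  refine ⟨?_, ?_, ?_⟩
  · let L : ((J → ι → ℝ) × (J → ℝ)) →L[ℝ] (ι → ℝ) :=
      ContinuousLinearMap.pi fun a =>
        r • ((ContinuousLinearMap.proj (R := ℝ) (φ := fun _ : ι => ℝ) a).comp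
          ((ContinuousLinearMap.proj (R := ℝ) (φ := fun _ : J => ι → ℝ) (b a)).comp
            (ContinuousLinearMap.fst ℝ _ _))) +
        (ContinuousLinearMap.proj (R := ℝ) (φ := fun _ : J => ℝ) (b a)).comp
            (ContinuousLinearMap.snd ℝ _ _)
    have : (fun (p : (J → ι → ℝ) × (J → ℝ)) (a : ι) => r * p.1 (b a) a + p.2 (b a)) = L := by
      ext p a; simp [L]
    rw [hQ, this]
    infer_instance
  · intro a
    rw [hQ, integral_map hm.aemeasurable (Measurable.aestronglyMeasurable (by fun_prop))]
    have j1 : Integrable (fun p : (J → ι → ℝ) × (J → ℝ) => p.1 (b a) a)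
      (PP.prod G) :=
        ((m1 (b a) a).integrable (by simp)).comp_fst G
    have j2 : Integrable (fun p : (J → ι → ℝ) × (J → ℝ) => p.2 (b a))
      (PP.prod G) :=
        ((m2 (b a)).integrable (by simp)).comp_snd _
    rw [integral_add (j1.const_mul r) j2, integral_const_mul]
    have := integral_fun_fst (μ := PP) (ν := G) (fun x : J → ι → ℝ => x (b a) a)
    rw [this, i1]
    have := integral_fun_snd (μ := PP) (ν := G) (fun x : J → ℝ => x (b a))
    rw [this, hG0]
    simp
  · intro a a'
    rw [hQ, integral_map hm.aemeasurable (Measurable.aestronglyMeasurable (by fun_prop))]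
    have k1 : MemLp (fun p : (J → ι → ℝ) × (J → ℝ) => p.1 (b a) a) 2 (PP.prod G) := (m1 _ _).comp_fst G
    have k1' : MemLp (fun p : (J → ι → ℝ) × (J → ℝ) => p.1 (b a') a') 2 (PP.prod G) := (m1 _ _).comp_fst G
    have k2 : MemLp (fun p : (J → ι → ℝ) × (J → ℝ) => p.2 (b a)) 2 (PP.prod G) := (m2 _).comp_snd _
    have k2' : MemLp (fun p : (J → ι → ℝ) × (J → ℝ) => p.2 (b a')) 2 (PP.prod G) := (m2 _).comp_snd _
    have e : ∀ p : (J → ι → ℝ) × (J → ℝ), (r * p.1 (b a) a + p.2 (b a)) * (r * p.1 (b a') a' + p.2 (b a'))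
        = (r ^ 2 * (p.1 (b a) a * p.1 (b a') a') + r * (p.1 (b a) a * p.2 (b a'))) +
          (r * (p.1 (b a') a' * p.2 (b a)) + p.2 (b a) * p.2 (b a')) := by
      intro p; ring
    simp_rw [e]
    have l1 := (k1.integrable_mul k1').const_mul (r ^ 2)
    have l2 := (k1.integrable_mul k2').const_mul r
    have l3 := (k1'.integrable_mul k2).const_mul r
    have l4 := k2.integrable_mul k2'
    simp only [Pi.mul_apply] at l1 l2 l3
    have l12 := l1.add l2
    have l34 := l3.add l4
    have eq1 := integral_add l12 l34
    have eq2 := integral_add l1 l2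
    have eq3 := integral_add l3 l4
    simp only [Pi.add_apply, Pi.mul_apply] at eq1 eq2 eq3
    rw [eq1, eq2, eq3, integral_const_mul, integral_const_mul, integral_const_mul]
    have h1 := integral_fun_fst (μ := PP) (ν := G) (fun x => x (b a) a * x (b a') a')
    have h2 := integral_fun_snd (μ := PP) (ν := G) (fun x => x (b a) * x (b a'))
    have h3 := integral_prod_mul (μ := PP) (ν := G) (fun x => x (b a) a) (fun x => x (b a'))
    have h4 := integral_prod_mul (μ := PP) (ν := G) (fun x => x (b a') a') (fun x => x (b a))
    rw [h1, h2, h3, h4, i1, i1, i2]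
    simp


lemma ms_le {ι : Type*} [Fintype ι] (s : ι → Prop) (c : ℝ) :
    MeasurableSet {x : ι → ℝ | ∀ a, s a → x a ≤ c} := by
  have : {x : ι → ℝ | ∀ a, s a → x a ≤ c} = ⋂ a, ⋂ (_ : s a), {x | x a ≤ c} := by ext; simp
  rw [this]
  exact MeasurableSet.iInter fun a => MeasurableSet.iInter fun _ =>
    measurableSet_le (measurable_pi_apply a) measurable_const

lemma slepian_enn {ι : Type*} [Fintype ι]
    (P Q : Measure (ι → ℝ)) [IsGaussian P] [IsGaussian Q] (hP0 : ∀ a, ∫ x, x a ∂P = 0)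
    (hQ0 : ∀ a, ∫ x, x a ∂Q = 0) (hd : ∀ a, ∫ x, x a * x a ∂P = ∫ x, x a * x a ∂Q)
    (hle : ∀ a b, ∫ x, x a * x b ∂P ≤ ∫ x, x a * x b ∂Q) (c : ℝ) :
    P {x | ∀ a, x a ≤ c} ≤ Q {x | ∀ a, x a ≤ c} := by
  have := slepian_measure P Q hP0 hQ0 hd hle c
  rwa [measureReal_def, measureReal_def, ENNReal.toReal_le_toReal (by simp) (by simp)] at this

/-- The block product formula on the comparison space. -/
lemma block_prob {ι J : Type*} [Fintype ι] [Fintype J] [DecidableEq J]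
    (P : Measure (ι → ℝ)) [IsProbabilityMeasure P]
    (G : Measure (J → ℝ)) [IsProbabilityMeasure G] (b : ι → J) (r c : ℝ)
    (Q : Measure (ι → ℝ)) (hQ : Q = ((Measure.pi fun _ : J => P).prod G).map
      (fun p a => r * p.1 (b a) a + p.2 (b a))) :
    Q {x | ∀ a, x a ≤ c} =
      ∫⁻ y, ∏ j, P {x | ∀ a, b a = j → r * x a + y j ≤ c} ∂G := by
  have hm : Measurable (fun (p : (J → ι → ℝ) × (J → ℝ)) (a : ι) => r * p.1 (b a) a + p.2 (b a)) := by
    fun_prop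
  have hs : MeasurableSet {x : ι → ℝ | ∀ a, x a ≤ c} := by simpa using ms_le (fun _ : ι => True) c
  rw [hQ, Measure.map_apply hm hs, Measure.prod_apply_symm (hm hs)]
  congr 1; ext y
  rw [← Measure.pi_pi]
  congr 1; ext x
  simp only [mem_preimage, mem_ofPred_eq, Set.mem_pi, mem_univ, true_implies]
  constructor
  · rintro h j a rfl; exact h a
  · intro h a; exact h _ a rfl

lemma block_lower {ι J : Type*} [Fintype ι] [Fintype J] [DecidableEq J]
    (P : Measure (ι → ℝ)) [IsGaussian P] (hP0 : ∀ a, ∫ x, x a ∂P = 0)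
    (hnn : ∀ a a', 0 ≤ ∫ x, x a * x a' ∂P) (b : ι → J) (c : ℝ) :
    ∏ j, P {x | ∀ a, b a = j → x a ≤ c} ≤ P {x | ∀ a, x a ≤ c} := by
  obtain ⟨Q, hQ⟩ : ∃ Q, Q = ((Measure.pi fun _ : J => P).prod (Measure.dirac (0 : J → ℝ))).map
      (fun p a => 1 * p.1 (b a) a + p.2 (b a)) := ⟨_, rfl⟩
  obtain ⟨q1, q2, q3⟩ := block_law P hP0 (Measure.dirac 0) (by simp) b 1 Q hQ
  have q4 := block_prob P (Measure.dirac 0) b 1 c Q hQ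
  rw [lintegral_dirac] at q4
  simp only [one_mul, Pi.zero_apply, add_zero] at q4
  rw [← q4]
  refine slepian_enn Q P q2 hP0 ?_ ?_ c
  · intro a; rw [q3]; simp
  · intro a a'
    rw [q3]
    split_ifs
    · simp
    · simpa using hnn a a'

lemma gauss_exp {J : Type*} [Fintype J] (G : Measure (J → ℝ)) [IsGaussian G]
    (hG0 : ∀ a, ∫ x, x a ∂G = 0) (S : Finset J) (V l : ℝ)
    (hV : ∑ i ∈ S, ∑ j ∈ S, ∫ x, x i * x j ∂G ≤ V) :
    ∫⁻ y, ENNReal.ofReal (Real.exp (-l * ∑ j ∈ S, y j)) ∂G ≤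
      ENNReal.ofReal (Real.exp (l ^ 2 * V / 2)) := by
  let L : StrongDual ℝ (J → ℝ) := ∑ j ∈ S, ContinuousLinearMap.proj (R := ℝ) (φ := fun _ : J => ℝ) j
  have hL : ∀ y, L y = ∑ j ∈ S, y j := by intro y; simp [L]
  have hmap : G.map L = gaussianReal (G[L]) (Var[L; G].toNNReal) := IsGaussian.map_eq_gaussianReal L
  have hmean : G[L] = 0 := by
    simp_rw [hL]
    rw [integral_finsetSum _ fun j _ => gauss_int_eval G j]
    simp [hG0]
  have hvar : Var[L; G] ≤ V := by
    rw [variance_of_integral_eq_zero L.continuous.aemeasurable hmean]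
    refine le_of_eq_of_le ?_ hV
    simp_rw [hL, sq, Finset.sum_mul_sum]
    rw [integral_finsetSum _ fun j _ => integrable_finsetSum _ fun i _ => gauss_int_mul G j i]
    refine Finset.sum_congr rfl fun i _ => ?_
    rw [integral_finsetSum _ fun j _ => gauss_int_mul G i j]
  rw [hmean] at hmap
  have hm := mgf_gaussianReal hmap (-l)
  have hExpInt : Integrable (fun y => Real.exp (-l * L y)) G := by
    rw [← mgf_pos_iff, hm]; exact Real.exp_pos _
  simp_rw [← hL]
  rw [← ofReal_integral_eq_lintegral_ofReal hExpInt (Eventually.of_forall fun _ => (Real.exp_pos _).le)]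
  refine ENNReal.ofReal_le_ofReal ?_
  change mgf L G (-l) ≤ _
  rw [hm]
  refine Real.exp_le_exp.2 ?_
  rw [Real.coe_toNNReal _ (variance_nonneg _ _)]
  nlinarith [sq_nonneg l]

lemma block_upper {ι J : Type*} [Fintype ι] [Fintype J] [DecidableEq J]
    (P : Measure (ι → ℝ)) [IsGaussian P] (hP0 : ∀ a, ∫ x, x a ∂P = 0)
    (hP1 : ∀ a, ∫ x, x a * x a ∂P = 1) (b : ι → J)
    (G : Measure (J → ℝ)) [IsGaussian G] (hG0 : ∀ a, ∫ x, x a ∂G = 0)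
    (γ : ℝ) (hγ : 0 < γ) (hγ1 : γ < 1) (hG1 : ∀ j, ∫ x, x j * x j ∂G = γ)
    (hcov : ∀ a a', b a ≠ b a' → ∫ x, x a * x a' ∂P ≤ ∫ x, x (b a) * x (b a') ∂G)
    (hV : ∀ S : Finset J, ∑ i ∈ S, ∑ j ∈ S, ∫ x, x i * x j ∂G ≤ 2 * γ * S.card)
    (z : ℝ) (hz : 0 < z) :
    P {x | ∀ a, x a ≤ 0} ≤ ∏ j, (ENNReal.ofReal (Real.exp (-(z ^ 2 / (4 * γ)))) +
      P {x | ∀ a, b a = j → x a ≤ z / Real.sqrt (1 - γ)}) := by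
  set r := Real.sqrt (1 - γ) with hr
  have hr0 : 0 < r := Real.sqrt_pos.2 (by linarith)
  have hr2 : r ^ 2 = 1 - γ := Real.sq_sqrt (by linarith)
  obtain ⟨Q, hQ⟩ : ∃ Q, Q = ((Measure.pi fun _ : J => P).prod G).map
      (fun p a => r * p.1 (b a) a + p.2 (b a)) := ⟨_, rfl⟩
  obtain ⟨q1, q2, q3⟩ := block_law P hP0 G hG0 b r Q hQ
  have q4 := block_prob P G b r 0 Q hQ
  have hle1 : ∀ a a', ∫ x, x a * x a' ∂P ≤ 1 := by
    intro a a'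
    have : ∫ x, x a * x a' ∂P ≤ ∫ x, ((1/2) * (x a * x a) + (1/2) * (x a' * x a')) ∂P := by
      refine integral_mono (gauss_int_mul P a a')
        (((gauss_int_mul P a a).const_mul _).add ((gauss_int_mul P a' a').const_mul _)) fun x => ?_
      simp only
      nlinarith [sq_nonneg (x a - x a')]
    rw [integral_add ((gauss_int_mul P a a).const_mul _) ((gauss_int_mul P a' a').const_mul _),
      integral_const_mul, integral_const_mul, hP1, hP1] at this
    linarith
  have hs : P {x | ∀ a, x a ≤ 0} ≤ Q {x | ∀ a, x a ≤ 0} := by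
    refine slepian_enn P Q hP0 q2 ?_ ?_ 0
    · intro a; rw [q3, if_pos rfl, hP1, hr2, hG1]; ring
    · intro a a'
      rw [q3, hr2]
      split_ifs with h
      · rw [h, hG1]
        nlinarith [hle1 a a']
      · simpa using hcov a a' h
  refine hs.trans ?_
  rw [q4]
  set p : J → ENNReal := fun j => P {x | ∀ a, b a = j → x a ≤ z / r} with hp
  set l := z / (2 * γ) with hl
  have hl0 : 0 < l := by positivity
  calc ∫⁻ y, ∏ j, P {x | ∀ a, b a = j → r * x a + y j ≤ 0} ∂G
      ≤ ∫⁻ y, ∏ j, (ENNReal.ofReal (Real.exp (-l * (y j + z))) + p j) ∂G := by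
        refine lintegral_mono fun y => Finset.prod_le_prod' fun j _ => ?_
        by_cases hy : -z ≤ y j
        · refine le_add_left (measure_mono fun x hx a ha => ?_)
          rw [le_div_iff₀ hr0]
          have := hx a ha
          nlinarith
        · push Not at hy
          refine le_add_right (prob_le_one.trans ?_)
          rw [ENNReal.one_le_ofReal, Real.one_le_exp_iff]
          nlinarith
    _ = ∑ S ∈ (Finset.univ : Finset J).powerset, ∫⁻ y, (∏ j ∈ S, ENNReal.ofReal (Real.exp (-l * (y j + z)))) *
          ∏ j ∈ Finset.univ \ S, p j ∂G := by
        simp_rw [Finset.prod_add]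
        rw [lintegral_finsetSum]
        intro S _
        fun_prop
    _ ≤ ∑ S ∈ (Finset.univ : Finset J).powerset,
          (∏ j ∈ S, ENNReal.ofReal (Real.exp (-(z ^ 2 / (4 * γ))))) * ∏ j ∈ Finset.univ \ S, p j := by
        refine Finset.sum_le_sum fun S _ => ?_
        rw [lintegral_mul_const _ (by fun_prop)]
        gcongr
        have e : ∀ y : J → ℝ, ∏ j ∈ S, ENNReal.ofReal (Real.exp (-l * (y j + z))) =
            ENNReal.ofReal (Real.exp (-l * z * S.card)) *
              ENNReal.ofReal (Real.exp (-l * ∑ j ∈ S, y j)) := by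
          intro y
          rw [← ENNReal.ofReal_prod_of_nonneg (fun _ _ => (Real.exp_pos _).le), ← Real.exp_sum,
            ← ENNReal.ofReal_mul (Real.exp_pos _).le, ← Real.exp_add]
          congr 2
          rw [← Finset.mul_sum, Finset.sum_add_distrib]
          simp; ring
        simp_rw [e]
        rw [lintegral_const_mul _ (by fun_prop)]
        refine (mul_le_mul_right (gauss_exp G hG0 S _ l (hV S)) _).trans ?_
        rw [← ENNReal.ofReal_mul (Real.exp_pos _).le, ← Real.exp_add,
          ← ENNReal.ofReal_prod_of_nonneg (fun _ _ => (Real.exp_pos _).le), ← Real.exp_sum]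
        refine ENNReal.ofReal_le_ofReal (Real.exp_le_exp.2 (le_of_eq ?_))
        rw [Finset.sum_const, nsmul_eq_mul, hl]
        field_simp
        ring
    _ = _ := by rw [Finset.prod_add]


lemma exists_G {J : Type*} [Fintype J] [DecidableEq J] (C : J → J → ℝ) (γ : ℝ)
    (hsymm : ∀ i j, C i j = C j i) (hnn : ∀ i j, 0 ≤ C i j) (hdiag : ∀ i, C i i = 0)
    (hrow : ∀ i, ∑ j, C i j ≤ γ) :
    ∃ G : Measure (J → ℝ), IsGaussian G ∧ (∀ a, ∫ x, x a ∂G = 0) ∧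
      (∀ j, ∫ x, x j * x j ∂G = γ) ∧ (∀ i j, i ≠ j → ∫ x, x i * x j ∂G = C i j) ∧
      (∀ S : Finset J, ∑ i ∈ S, ∑ j ∈ S, ∫ x, x i * x j ∂G ≤ 2 * γ * S.card) := by
  set B : Matrix J J ℝ := fun i j => (if i = j then γ else 0) + C i j with hB
  have hpsd : B.PosSemidef := by
    refine Matrix.PosSemidef.of_dotProduct_mulVec_nonneg ?_ ?_
    · ext i j
      rw [Matrix.conjTranspose_apply]
      simp only [hB, star_trivial, hsymm j i, eq_comm]
    · intro x
      have e1 : star x ⬝ᵥ B.mulVec x = γ * ∑ i, x i ^ 2 + ∑ i, ∑ j, C i j * (x i * x j) := by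
        simp only [dotProduct, Matrix.mulVec, hB, star_trivial, Pi.star_apply, add_mul,
          Finset.sum_add_distrib, mul_add, Finset.mul_sum]
        congr 1
        · refine Finset.sum_congr rfl fun i _ => ?_
          simp; ring
        · refine Finset.sum_congr rfl fun i _ => Finset.sum_congr rfl fun j _ => ?_
          ring
      have e2 : 0 ≤ ∑ i, ∑ j, C i j * (x i + x j) ^ 2 :=
        Finset.sum_nonneg fun i _ => Finset.sum_nonneg fun j _ => mul_nonneg (hnn _ _) (sq_nonneg _)
      have e3 : ∑ i, ∑ j, C i j * (x i + x j) ^ 2 =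
          ∑ i, ∑ j, C i j * x i ^ 2 + ∑ i, ∑ j, C i j * x j ^ 2 +
            2 * ∑ i, ∑ j, C i j * (x i * x j) := by
        simp only [Finset.mul_sum, ← Finset.sum_add_distrib]
        refine Finset.sum_congr rfl fun i _ => Finset.sum_congr rfl fun j _ => ?_
        ring
      have e4 : ∑ i, ∑ j, C i j * x j ^ 2 = ∑ i, ∑ j, C i j * x i ^ 2 := by
        rw [Finset.sum_comm]
        refine Finset.sum_congr rfl fun i _ => Finset.sum_congr rfl fun j _ => ?_
        rw [hsymm]
      have e5 : ∑ i, ∑ j, C i j * x i ^ 2 ≤ γ * ∑ i, x i ^ 2 := by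
        rw [Finset.mul_sum]
        refine Finset.sum_le_sum fun i _ => ?_
        rw [← Finset.sum_mul]
        exact mul_le_mul_of_nonneg_right (hrow i) (sq_nonneg _)
      rw [e1]
      linarith
  let L : EuclideanSpace ℝ J ≃L[ℝ] (J → ℝ) := EuclideanSpace.equiv J ℝ
  have hm : Measurable (L : EuclideanSpace ℝ J → J → ℝ) := L.continuous.measurable
  have hev : ∀ x j, L x j = x j := fun _ _ => rfl
  have mean : ∀ j, ∫ x : EuclideanSpace ℝ J, x j ∂(multivariateGaussian 0 B) = 0 := by
    intro j
    have h := integral_id_multivariateGaussian (μ := (0 : EuclideanSpace ℝ J)) (S := B)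
    have h2 := (EuclideanSpace.proj j : EuclideanSpace ℝ J →L[ℝ] ℝ).integral_comp_comm
      (IsGaussian.integrable_id (μ := multivariateGaussian (0 : EuclideanSpace ℝ J) B))
    simp only [id, h] at h2
    simpa using h2
  have cov : ∀ i j, ∫ x : EuclideanSpace ℝ J, x i * x j ∂(multivariateGaussian 0 B) = B i j := by
    intro i j
    rw [← covariance_eval_multivariateGaussian (μ := (0 : EuclideanSpace ℝ J)) hpsd i j]
    simp [covariance, mean]
  have cov' : ∀ i j, ∫ x, x i * x j ∂((multivariateGaussian 0 B).map L) = B i j := by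
    intro i j
    rw [integral_map hm.aemeasurable (Measurable.aestronglyMeasurable (by fun_prop)), ← cov]
    rfl
  refine ⟨(multivariateGaussian 0 B).map L, ?_, ?_, ?_, ?_, ?_⟩
  · exact isGaussian_map_equiv L
  · intro a
    rw [integral_map hm.aemeasurable (Measurable.aestronglyMeasurable (by fun_prop)), ← mean a]
    rfl
  · intro j; rw [cov']; simp [hB, hdiag]
  · intro i j hij; rw [cov']; simp [hB, hij]
  · intro S
    simp_rw [cov']
    have : ∀ i ∈ S, ∑ j ∈ S, B i j ≤ 2 * γ := by
      intro i hi
      have : ∑ j ∈ S, C i j ≤ ∑ j, C i j :=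
        Finset.sum_le_sum_of_subset_of_nonneg (Finset.subset_univ _) fun j _ _ => hnn _ _
      simp only [hB, Finset.sum_add_distrib]
      rw [Finset.sum_ite_eq, if_pos hi]
      linarith [hrow i]
    refine (Finset.sum_le_sum this).trans_eq ?_
    simp; ring

section process
variable {Ω : Type*} [MeasurableSpace Ω] (μ : Measure Ω) [IsProbabilityMeasure μ]
  (Z : ℝ → Ω → ℝ)

lemma gp_aem (hG : IsCenteredGaussianProcess μ Z) (t : ℝ) : AEMeasurable (Z t) μ := by
  obtain ⟨v, hv⟩ := hG 1 (fun _ => 1) (fun _ => t)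
  simp only [Finset.univ_unique, one_mul, Finset.sum_const, Finset.card_singleton, one_smul] at hv
  exact aemeasurable_of_map_neZero (by rw [hv]; infer_instance)

lemma gp_law {ι : Type*} [Fintype ι] (hG : IsCenteredGaussianProcess μ Z) (t : ι → ℝ)
    (P : Measure (ι → ℝ)) (hP : P = μ.map (fun ω a => Z (t a) ω)) :
    IsGaussian P ∧ (∀ a, ∫ x, x a ∂P = 0) ∧
      (∀ a a', ∫ x, x a * x a' ∂P = ∫ ω, Z (t a) ω * Z (t a') ω ∂μ) ∧
      ∀ s, MeasurableSet s → P s = μ ((fun ω a => Z (t a) ω) ⁻¹' s) := by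
  classical
  have hm : AEMeasurable (fun ω a => Z (t a) ω) μ := aemeasurable_pi_iff.2 fun a => gp_aem μ Z hG (t a)
  refine ⟨?_, ?_, ?_, ?_⟩
  · refine isGaussian_of_map_eq_gaussianReal fun L => ⟨0, ?_⟩
    let e := Fintype.equivFin ι
    obtain ⟨v, hv⟩ := hG (Fintype.card ι) (fun i => L (Pi.single (e.symm i) 1)) (fun i => t (e.symm i))
    refine ⟨v, ?_⟩
    rw [hP, AEMeasurable.map_map_of_aemeasurable L.continuous.aemeasurable hm, ← hv]
    congr 1
    ext ω
    have hx : ∀ x : ι → ℝ, L x = ∑ i, L (Pi.single i 1) * x i := by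
      intro x
      conv_lhs => rw [pi_eq_sum_univ' x]
      rw [map_sum]
      refine Finset.sum_congr rfl fun i _ => ?_
      rw [map_smul, smul_eq_mul, mul_comm]
    simp only [Function.comp_apply]
    rw [hx]
    exact (Equiv.sum_comp e.symm fun i => L (Pi.single i 1) * Z (t i) ω).symm
  · intro a
    rw [hP, integral_map hm (Measurable.aestronglyMeasurable (by fun_prop))]
    obtain ⟨v, hv⟩ := hG 1 (fun _ => 1) (fun _ => t a)
    simp only [Finset.univ_unique, one_mul, Finset.sum_const, Finset.card_singleton, one_smul] at hv
    have h := integral_map (μ := μ) (f := fun x : ℝ => x) (gp_aem μ Z hG (t a))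
      (Measurable.aestronglyMeasurable (by fun_prop))
    rw [← h]
    change ∫ x, x ∂(Measure.map (fun ω => Z (t a) ω) μ) = 0
    rw [hv]; simp
  · intro a a'
    rw [hP, integral_map hm (Measurable.aestronglyMeasurable (by fun_prop))]
  · intro s hs
    rw [hP, Measure.map_apply_of_aemeasurable hm hs]

end process


/-- The event that the process stays below the level `c` on `S`. -/
def evl {Ω : Type*} (Z : ℝ → Ω → ℝ) (S : Set ℝ) (c : ℝ) : Set Ω := {ω | ∀ t ∈ S, Z t ω ≤ c}

/-- The event that the process stays strictly below the level `c` on `S`. -/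
def evs {Ω : Type*} (Z : ℝ → Ω → ℝ) (S : Set ℝ) (c : ℝ) : Set Ω := {ω | ∀ t ∈ S, Z t ω < c}

lemma dense_fin (S : Set ℝ) : ∃ F : ℕ → Finset ℝ, Monotone F ∧ (∀ n, (F n : Set ℝ) ⊆ S) ∧
    ∀ (f : ℝ → ℝ), Continuous f → ∀ c, (∀ n, ∀ t ∈ F n, f t ≤ c) → ∀ t ∈ S, f t ≤ c := by
  classical
  rcases S.eq_empty_or_nonempty with rfl | hS
  · exact ⟨fun _ => ∅, fun _ _ _ => le_rfl, by simp, by simp⟩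
  have : Nonempty S := hS.to_subtype
  let u : ℕ → S := TopologicalSpace.denseSeq S
  refine ⟨fun n => (Finset.range n).image fun i => (u i : ℝ), ?_, ?_, ?_⟩
  · intro n m h
    exact Finset.image_subset_image (Finset.range_subset_range.2 h)
  · intro n t ht
    simp only [Finset.coe_image, mem_image] at ht
    obtain ⟨i, _, rfl⟩ := ht
    exact (u i).2
  · intro f hf c h t ht
    have hcl : IsClosed {x : S | f x ≤ c} :=
      isClosed_le (hf.comp continuous_subtype_val) continuous_const
    have hsub : Set.range u ⊆ {x : S | f x ≤ c} := by
      rintro _ ⟨i, rfl⟩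
      exact h (i + 1) _ (Finset.mem_image.2 ⟨i, by simp, rfl⟩)
    have := closure_minimal hsub hcl
    rw [(TopologicalSpace.denseRange_denseSeq S).closure_range] at this
    exact this (mem_univ (⟨t, ht⟩ : S))

section process
variable {Ω : Type*} [MeasurableSpace Ω] (μ : Measure Ω) [IsProbabilityMeasure μ]
  (Z : ℝ → Ω → ℝ)

lemma evl_null (hG : IsCenteredGaussianProcess μ Z) (F : Finset ℝ) (c : ℝ) :
    NullMeasurableSet (evl Z F c) μ := by
  have : evl Z F c = ⋂ t ∈ F, {ω | Z t ω ≤ c} := by ext; simp [evl]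
  rw [this]
  exact Finset.nullMeasurableSet_biInter F fun t _ =>
    nullMeasurableSet_le (gp_aem μ Z hG t) aemeasurable_const

lemma evl_tendsto (hG : IsCenteredGaussianProcess μ Z) (hc : ∀ ω, Continuous fun t => Z t ω)
    (S : Set ℝ) : ∃ F : ℕ → Finset ℝ, (∀ n, (F n : Set ℝ) ⊆ S) ∧ ∀ c,
      Tendsto (fun n => μ.real (evl Z (F n) c)) atTop (nhds (μ.real (evl Z S c))) := by
  obtain ⟨F, hmono, hsub, hF⟩ := dense_fin S
  refine ⟨F, hsub, fun c => ?_⟩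
  have e : evl Z S c = ⋂ n, evl Z (F n) c := by
    ext ω
    simp only [evl, mem_iInter, mem_ofPred_eq]
    exact ⟨fun h n t ht => h t (hsub n ht), fun h => hF _ (hc ω) c h⟩
  rw [e]
  have := tendsto_measure_iInter_atTop (μ := μ) (s := fun n => evl Z (F n) c)
    (fun n => evl_null μ Z hG (F n) c)
    (fun n m h ω hω t ht => hω t (hmono h ht)) ⟨0, by simp⟩
  exact (ENNReal.tendsto_toReal (by simp)).comp this

lemma lower_fin {J : Type*} [Fintype J] (hG : IsCenteredGaussianProcess μ Z)
    (hnn : ∀ s t, 0 ≤ ∫ ω, Z s ω * Z t ω ∂μ) (S : J → Set ℝ) (H : Finset ℝ)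
    (hH : ∀ t ∈ H, ∃ j, t ∈ S j) (c : ℝ) :
    ∏ j, μ.real (evl Z (S j) c) ≤ μ.real (evl Z H c) := by
  classical
  choose b hb using fun t : H => hH t t.2
  obtain ⟨P, hP⟩ : ∃ P, P = μ.map (fun ω (a : H) => Z a ω) := ⟨_, rfl⟩
  obtain ⟨p1, p2, p3, p4⟩ := gp_law μ Z hG (fun a : H => (a : ℝ)) P hP
  have h := block_lower P p2 (fun a a' => by rw [p3]; exact hnn _ _) b c
  rw [p4 _ (by simpa using ms_le (fun _ : H => True) c)] at h
  have e : (fun ω (a : H) => Z a ω) ⁻¹' {x | ∀ a, x a ≤ c} = evl Z H c := by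
    ext ω; simp [evl]
  rw [e] at h
  simp only [measureReal_def]
  rw [← ENNReal.toReal_prod]
  refine ENNReal.toReal_mono (by simp) (le_trans ?_ h)
  refine Finset.prod_le_prod' fun j _ => ?_
  rw [p4 _ (ms_le (fun a => b a = j) c)]
  refine measure_mono fun ω hω => ?_
  simp only [mem_preimage, mem_ofPred_eq]
  rintro a rfl
  exact hω _ (hb a)

lemma lower_sets {J : Type*} [Fintype J] (hG : IsCenteredGaussianProcess μ Z)
    (hc : ∀ ω, Continuous fun t => Z t ω)
    (hnn : ∀ s t, 0 ≤ ∫ ω, Z s ω * Z t ω ∂μ) (S : J → Set ℝ) (c : ℝ) :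
    ∏ j, μ.real (evl Z (S j) c) ≤ μ.real (evl Z (⋃ j, S j) c) := by
  obtain ⟨F, hsub, hF⟩ := evl_tendsto μ Z hG hc (⋃ j, S j)
  exact ge_of_tendsto' (hF c) fun n =>
    lower_fin μ Z hG hnn S (F n) (fun t ht => by simpa using hsub n ht) c

lemma evs_tendsto (hc : ∀ ω, Continuous fun t => Z t ω) (S : Set ℝ) (hS : IsCompact S) :
    Tendsto (fun n : ℕ => μ.real (evl Z S (-(1 / ((n:ℝ) + 1))))) atTop (nhds (μ.real (evs Z S 0))) := by
  have e : evs Z S 0 = ⋃ n : ℕ, evl Z S (-(1 / ((n:ℝ) + 1))) := by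
    ext ω
    simp only [evl, evs, mem_iUnion, mem_ofPred_eq]
    constructor
    · intro h
      rcases S.eq_empty_or_nonempty with rfl | hne
      · exact ⟨0, by simp⟩
      obtain ⟨x, hx, hmax⟩ := hS.exists_isMaxOn hne (hc ω).continuousOn
      obtain ⟨n, hn⟩ := exists_nat_one_div_lt (show 0 < -Z x ω by linarith [h x hx])
      refine ⟨n, fun t ht => ?_⟩
      have : Z t ω ≤ Z x ω := hmax ht
      linarith
    · rintro ⟨n, h⟩ t ht
      have : (0:ℝ) < 1 / ((n:ℝ) + 1) := by positivity
      linarith [h t ht]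
  rw [e]
  refine (ENNReal.tendsto_toReal (by simp)).comp (tendsto_measure_iUnion_atTop ?_)
  intro n m h ω hω t ht
  refine (hω t ht).trans (neg_le_neg ?_)
  have : (n:ℝ) ≤ m := by exact_mod_cast h
  gcongr

lemma lower_strict {J : Type*} [Fintype J] (hG : IsCenteredGaussianProcess μ Z)
    (hc : ∀ ω, Continuous fun t => Z t ω)
    (hnn : ∀ s t, 0 ≤ ∫ ω, Z s ω * Z t ω ∂μ) (S : J → Set ℝ) (hS : ∀ j, IsCompact (S j)) :
    ∏ j, μ.real (evs Z (S j) 0) ≤ μ.real (evs Z (⋃ j, S j) 0) := by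
  refine le_of_tendsto' (tendsto_finsetProd _ fun j _ => evs_tendsto μ Z hc (S j) (hS j)) fun n => ?_
  refine (lower_sets μ Z hG hc hnn S _).trans (measureReal_mono fun ω hω t ht => ?_)
  have : (0:ℝ) < 1 / ((n:ℝ) + 1) := by positivity
  linarith [hω t ht]

lemma evs_pos (hG : IsCenteredGaussianProcess μ Z)
    (hc : ∀ ω, Continuous fun t => Z t ω) (hvar : ∀ t, ∫ ω, (Z t ω) ^ 2 ∂μ = 1)
    (hnn : ∀ s t, 0 ≤ ∫ ω, Z s ω * Z t ω ∂μ) (S : Set ℝ) (hS : IsCompact S) :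
    0 < μ.real (evs Z S 0) := by
  have hneg : ∀ n : ℕ, (0:ℝ) < 1 / ((n:ℝ) + 1) := fun n => by positivity
  have main : ∃ n : ℕ, 0 < μ.real (evl Z S (-(1 / ((n:ℝ) + 1)))) := by
    refine hS.induction_on (p := fun s => ∃ n : ℕ, 0 < μ.real (evl Z s (-(1 / ((n:ℝ) + 1))))) ?_ ?_ ?_ ?_
    · exact ⟨0, by simp [evl]⟩
    · rintro s t hst ⟨n, hn⟩
      exact ⟨n, hn.trans_le (measureReal_mono fun ω hω x hx => hω x (hst hx))⟩
    · rintro s t ⟨n, hn⟩ ⟨m, hm⟩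
      refine ⟨max n m, ?_⟩
      have h := lower_sets μ Z hG hc hnn (fun j : Bool => if j then s else t)
        (-(1 / (((max n m : ℕ):ℝ) + 1)))
      have e : (⋃ j : Bool, if j then s else t) = s ∪ t := by
        ext; simp [or_comm]
      rw [e] at h
      refine lt_of_lt_of_le ?_ h
      have key : ∀ k ≤ max n m, -(1 / ((k:ℝ) + 1)) ≤ -(1 / (((max n m : ℕ):ℝ) + 1)) := by
        intro k hk
        have : (k:ℝ) ≤ (max n m : ℕ) := by exact_mod_cast hk
        exact neg_le_neg (by gcongr)
      rw [Fintype.prod_bool]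
      refine mul_pos (hn.trans_le ?_) (hm.trans_le ?_)
      · exact measureReal_mono fun ω hω x hx => (hω x (by simpa using hx)).trans (key n (le_max_left _ _))
      · exact measureReal_mono fun ω hω x hx => (hω x (by simpa using hx)).trans (key m (le_max_right _ _))
    · intro x _
      have hpos : μ {ω | Z x ω < 0} ≠ 0 := by
        obtain ⟨v, hv⟩ := hG 1 (fun _ => 1) (fun _ => x)
        simp only [Finset.univ_unique, one_mul, Finset.sum_const, Finset.card_singleton, one_smul] at hv
        have hv0 : v ≠ 0 := by
          rintro rfl
          have h := integral_map (μ := μ) (f := fun y : ℝ => y ^ 2) (gp_aem μ Z hG x)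
            (Measurable.aestronglyMeasurable (by fun_prop))
          rw [hvar] at h
          have hv' : Measure.map (Z x) μ = gaussianReal 0 0 := hv
          rw [hv'] at h
          simp at h
        have hv' : Measure.map (Z x) μ = gaussianReal 0 v := hv
        have h2 : μ {ω | Z x ω < 0} = gaussianReal 0 v (Iio 0) := by
          rw [← hv', Measure.map_apply_of_aemeasurable (gp_aem μ Z hG x) measurableSet_Iio]
          rfl
        rw [h2]
        intro h0
        have := gaussianReal_absolutelyContinuous' 0 hv0 h0
        simp at this
      have hsub : {ω | Z x ω < 0} ⊆ ⋃ n : ℕ, evl Z (Metric.ball x (1 / ((n:ℝ) + 1))) (-(1 / ((n:ℝ) + 1))) := by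
        intro ω hω
        have hω' : Z x ω < 0 := hω
        have hev : ∀ᶠ y in nhds x, Z y ω < Z x ω / 2 :=
          (hc ω).continuousAt.eventually_lt_const (by linarith)
        obtain ⟨ε, hε, hball⟩ := Metric.eventually_nhds_iff_ball.1 hev
        obtain ⟨n, hn⟩ := exists_nat_one_div_lt (show 0 < min ε (-(Z x ω / 2)) from
          lt_min hε (by linarith))
        refine mem_iUnion.2 ⟨n, fun t ht => ?_⟩
        have h1 := hball t (Metric.ball_subset_ball (hn.le.trans (min_le_left _ _)) ht)
        have h2 := hn.le.trans (min_le_right _ _)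
        linarith
      obtain ⟨n, hn⟩ : ∃ n : ℕ,
          μ (evl Z (Metric.ball x (1 / ((n:ℝ) + 1))) (-(1 / ((n:ℝ) + 1)))) ≠ 0 := by
        by_contra! hcon
        exact hpos (measure_mono_null hsub (measure_iUnion_null hcon))
      exact ⟨_, mem_nhdsWithin_of_mem_nhds (Metric.ball_mem_nhds x (hneg n)), n,
        ENNReal.toReal_pos hn (by simp)⟩
  obtain ⟨n, hn⟩ := main
  refine hn.trans_le (measureReal_mono fun ω hω t ht => ?_)
  linarith [hω t ht, hneg n]

lemma upper_fin {J : Type*} [Fintype J] [DecidableEq J] (hG : IsCenteredGaussianProcess μ Z)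
    (hvar : ∀ t, ∫ ω, (Z t ω) ^ 2 ∂μ = 1)
    (F : J → Finset ℝ) (C : J → J → ℝ) (γ : ℝ) (hγ : 0 < γ) (hγ1 : γ < 1)
    (hsymm : ∀ i j, C i j = C j i) (hnn : ∀ i j, 0 ≤ C i j) (hdiag : ∀ i, C i i = 0)
    (hrow : ∀ i, ∑ j, C i j ≤ γ)
    (hC : ∀ i j, i ≠ j → ∀ s ∈ F i, ∀ t ∈ F j, ∫ ω, Z s ω * Z t ω ∂μ ≤ C i j) (z : ℝ) (hz : 0 < z) :
    μ.real {ω | ∀ j, ∀ t ∈ F j, Z t ω ≤ 0} ≤ ∏ j, (Real.exp (-(z ^ 2 / (4 * γ))) +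
      μ.real (evl Z (F j) (z / Real.sqrt (1 - γ)))) := by
  obtain ⟨G, g1, g2, g3, g4, g5⟩ := exists_G C γ hsymm hnn hdiag hrow
  obtain ⟨P, hP⟩ : ∃ P, P = μ.map (fun ω (a : Σ j, F j) => Z a.2 ω) := ⟨_, rfl⟩
  obtain ⟨p1, p2, p3, p4⟩ := gp_law μ Z hG (fun a : (Σ j, F j) => (a.2 : ℝ)) P hP
  have h := block_upper P p2 (fun a => by rw [p3, ← hvar a.2]; simp_rw [sq]) (fun a => a.1) G g2 γ hγ hγ1
    g3 (fun a a' haa => by rw [p3, g4 _ _ haa]; exact hC _ _ haa _ a.2.2 _ a'.2.2) g5 z hz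
  rw [p4 _ (by simpa using ms_le (fun _ : (Σ j, F j) => True) 0)] at h
  have e : (fun ω (a : Σ j, F j) => Z a.2 ω) ⁻¹' {x | ∀ a, x a ≤ 0} =
      {ω | ∀ j, ∀ t ∈ F j, Z t ω ≤ 0} := by
    ext ω
    simp only [mem_preimage, mem_ofPred_eq]
    exact ⟨fun h j t ht => h ⟨j, t, ht⟩, fun h a => h a.1 a.2 a.2.2⟩
  rw [e] at h
  have h2 := ENNReal.toReal_mono ?_ h
  · rw [ENNReal.toReal_prod] at h2
    refine h2.trans_eq (Finset.prod_congr rfl fun j _ => ?_)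
    rw [ENNReal.toReal_add (by simp) (by simp), ENNReal.toReal_ofReal (Real.exp_pos _).le,
      p4 _ (ms_le (fun a : (Σ j, F j) => a.1 = j) _)]
    congr 2
    congr 1
    ext ω
    simp only [mem_preimage, mem_ofPred_eq, evl]
    constructor
    · intro h t ht; exact h ⟨j, t, ht⟩ rfl
    · rintro h a rfl; exact h a.2 a.2.2
  · exact ENNReal.prod_ne_top fun j _ => by simp

lemma upper_sets {J : Type*} [Fintype J] [DecidableEq J] (hG : IsCenteredGaussianProcess μ Z)
    (hc : ∀ ω, Continuous fun t => Z t ω) (hvar : ∀ t, ∫ ω, (Z t ω) ^ 2 ∂μ = 1)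
    (S : J → Set ℝ) (C : J → J → ℝ) (γ : ℝ) (hγ : 0 < γ) (hγ1 : γ < 1)
    (hsymm : ∀ i j, C i j = C j i) (hnn : ∀ i j, 0 ≤ C i j) (hdiag : ∀ i, C i i = 0)
    (hrow : ∀ i, ∑ j, C i j ≤ γ)
    (hC : ∀ i j, i ≠ j → ∀ s ∈ S i, ∀ t ∈ S j, ∫ ω, Z s ω * Z t ω ∂μ ≤ C i j) (z : ℝ) (hz : 0 < z) :
    μ.real (evl Z (⋃ j, S j) 0) ≤ ∏ j, (Real.exp (-(z ^ 2 / (4 * γ))) +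
      μ.real (evl Z (S j) (z / Real.sqrt (1 - γ)))) := by
  choose F hsub hF using fun j => evl_tendsto μ Z hG hc (S j)
  refine ge_of_tendsto' (tendsto_finsetProd _ fun j _ =>
    (hF j (z / Real.sqrt (1 - γ))).const_add _) fun n => ?_
  refine le_trans ?_ (upper_fin μ Z hG hvar (fun j => F j n) C γ hγ hγ1 hsymm hnn hdiag hrow
    (fun i j hij s hs t ht => hC i j hij s (hsub i n hs) t (hsub j n ht)) z hz)
  exact measureReal_mono fun ω hω j t ht => hω t (mem_iUnion.2 ⟨j, hsub j n ht⟩)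

end process


section process
variable {Ω : Type*} [MeasurableSpace Ω] (μ : Measure Ω) [IsProbabilityMeasure μ]
  (Z : ℝ → Ω → ℝ)

lemma lower_T (hG : IsCenteredGaussianProcess μ Z)
    (hc : ∀ ω, Continuous fun t => Z t ω)
    (hnn : ∀ s t, 0 ≤ ∫ ω, Z s ω * Z t ω ∂μ) (M T p : ℝ) (hM : 0 < M) (hT : 0 < T) (hp : 0 ≤ p)
    (hps : ∀ s, 0 ≤ s → p ≤ μ.real (evs Z (Icc s (s + M)) 0)) (N : ℕ) (hN : T ≤ N * M) :
    p ^ N ≤ μ.real (evs Z (Icc 0 T) 0) := by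
  have h := lower_strict μ Z hG hc hnn (fun j : Fin N => Icc ((j:ℝ) * M) ((j:ℝ) * M + M))
    (fun j => isCompact_Icc)
  have h1 : p ^ N ≤ ∏ j : Fin N, μ.real (evs Z (Icc ((j:ℝ) * M) ((j:ℝ) * M + M)) 0) := by
    calc p ^ N = ∏ j : Fin N, p := by simp
      _ ≤ _ := Finset.prod_le_prod (fun _ _ => hp) fun j _ => hps _ (by positivity)
  refine (h1.trans h).trans (measureReal_mono fun ω hω t ht => hω t ?_)
  have hN0 : 0 < N := by
    rcases Nat.eq_zero_or_pos N with rfl | h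
    · simp at hN; linarith
    · exact h
  rw [mem_iUnion]
  by_cases hlt : ⌊t / M⌋₊ < N
  · refine ⟨⟨⌊t / M⌋₊, hlt⟩, ?_, ?_⟩
    · have := Nat.floor_le (show 0 ≤ t / M from div_nonneg ht.1 hM.le)
      rw [le_div_iff₀ hM] at this
      exact this
    · have := (Nat.lt_floor_add_one (t / M)).le
      rw [div_le_iff₀ hM] at this
      simp only; linarith
  · push Not at hlt
    have h2 : (N:ℝ) ≤ t / M := (Nat.le_floor_iff (div_nonneg ht.1 hM.le)).1 hlt
    rw [le_div_iff₀ hM] at h2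
    have hNc : ((N - 1 : ℕ) : ℝ) = N - 1 := by rw [Nat.cast_sub hN0]; simp
    refine ⟨⟨N - 1, by omega⟩, ?_, ?_⟩
    · simp only [hNc]; nlinarith
    · simp only [hNc]; nlinarith [ht.2]

lemma upper_T (hG : IsCenteredGaussianProcess μ Z)
    (hc : ∀ ω, Continuous fun t => Z t ω) (hvar : ∀ t, ∫ ω, (Z t ω) ^ 2 ∂μ = 1)
    (η M g T z γ p : ℝ) (hη : 1 < η) (hM : 0 < M) (hg : 0 < g) (hz : 0 < z)
    (hγ : γ = (∑' m : ℤ, |(m:ℝ)| ^ (-η)) * g ^ (-η)) (hγ0 : 0 < γ) (hγ1 : γ < 1)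
    (hdec : ∀ τ ≥ g, ∀ s : ℝ, 0 ≤ s → ∫ ω, Z s ω * Z (s + τ) ω ∂μ ≤ τ ^ (-η))
    (hps : ∀ s, 0 ≤ s → μ.real (evl Z (Icc s (s + M)) (z / Real.sqrt (1 - γ))) ≤ p)
    (N : ℕ) (hN : N * (M + g) ≤ T) :
    μ.real (evs Z (Icc 0 T) 0) ≤ (Real.exp (-(z ^ 2 / (4 * γ))) + p) ^ N := by
  have hsum : Summable fun m : ℤ => |(m:ℝ)| ^ (-η) := Real.summable_abs_int_rpow hη
  set D := M + g with hD
  set C : Fin N → Fin N → ℝ := fun i j => |((i:ℝ) - j)| ^ (-η) * g ^ (-η) with hCdef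
  have hCsymm : ∀ i j, C i j = C j i := fun i j => by simp only [hCdef, abs_sub_comm]
  have key : ∀ i j : Fin N, i < j → ∀ s ∈ Icc ((i:ℝ) * D) ((i:ℝ) * D + M),
      ∀ t ∈ Icc ((j:ℝ) * D) ((j:ℝ) * D + M), ∫ ω, Z s ω * Z t ω ∂μ ≤ C i j := by
    intro i j hij s hs t ht
    have hij' : (i:ℝ) + 1 ≤ j := by exact_mod_cast hij
    have hs0 : 0 ≤ s := le_trans (by positivity) hs.1
    have h1 : ((j:ℝ) - i) * g ≤ t - s := by
      have := hs.2; have := ht.1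
      nlinarith
    have h2 : g ≤ t - s := le_trans (by nlinarith) h1
    have h3 := hdec (t - s) h2 s hs0
    rw [show s + (t - s) = t by ring] at h3
    refine h3.trans ?_
    have e : C i j = (((j:ℝ) - i) * g) ^ (-η) := by
      simp only [hCdef]
      rw [abs_sub_comm, abs_of_nonneg (by linarith), Real.mul_rpow (by linarith) hg.le]
    rw [e]
    exact Real.rpow_le_rpow_of_nonpos (mul_pos (by linarith) hg) h1 (by linarith)
  have h := upper_sets μ Z hG hc hvar (fun j : Fin N => Icc ((j:ℝ) * D) ((j:ℝ) * D + M)) C γ hγ0 hγ1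
    hCsymm (fun i j => by simp only [hCdef]; positivity)
    (fun i => by
      simp only [hCdef, sub_self, abs_zero]
      rw [Real.zero_rpow (by linarith), zero_mul])
    (fun i => by
      simp only [hCdef]
      rw [← Finset.sum_mul, hγ]
      refine mul_le_mul_of_nonneg_right ?_ (by positivity)
      have inj : Function.Injective fun j : Fin N => ((i : ℕ) : ℤ) - ((j : ℕ) : ℤ) := by
        intro a b hab
        simp only at hab
        ext; omega
      have := hsum.sum_le_tsum (Finset.univ.map ⟨_, inj⟩) (fun m _ => by positivity)
      refine le_trans (le_of_eq ?_) this
      rw [Finset.sum_map]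
      simp)
    (fun i j hij s hs t ht => by
      rcases lt_or_gt_of_ne hij with h | h
      · exact key i j h s hs t ht
      · rw [hCsymm]
        simp_rw [mul_comm (Z s _)]
        exact key j i h t ht s hs) z hz
  refine (measureReal_mono fun ω hω t ht => ?_).trans (h.trans ?_)
  · obtain ⟨j, hj⟩ := mem_iUnion.1 ht
    have hj1 : (j:ℝ) + 1 ≤ N := by exact_mod_cast j.2
    refine (hω t ⟨le_trans (by positivity) hj.1, hj.2.trans (le_trans ?_ hN)⟩).le
    nlinarith
  · calc _ ≤ ∏ j : Fin N, (Real.exp (-(z ^ 2 / (4 * γ))) + p) :=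
          Finset.prod_le_prod (fun _ _ => by positivity) fun j _ => by
            gcongr
            exact hps _ (by positivity)
      _ = _ := by simp

lemma evs_shift (s M z : ℝ) :
    {ω | ∀ t ∈ Icc (0:ℝ) M, Z (s + t) ω < z} = evs Z (Icc s (s + M)) z := by
  ext ω
  simp only [evs, mem_ofPred_eq]
  constructor
  · intro h t ht
    have := h (t - s) ⟨by linarith [ht.1], by linarith [ht.2]⟩
    rwa [show s + (t - s) = t by ring] at this
  · intro h t ht
    exact h _ ⟨by linarith [ht.1], by linarith [ht.2]⟩

end process


/-- **Continuity of persistence exponents for Gaussian processes.**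
Centered unit-variance Gaussian processes `Z^{(k)}` with nonnegative auto-correlations
`A_k`, and a limiting stationary process `Z^{(∞)}` with auto-correlation `A_∞` and
persistence exponent `b(A_∞) ∈ [0,∞]`, satisfying the uniform polynomial decay of
correlations (i), the stability of the exponent of the limit (ii), and the convergence of
maxima probabilities (iii). Then, jointly as `k, T → ∞`,
`(1/T) log P(sup_{[0,T]} Z^{(k)} < 0) → -b(A_∞)` (in the extended reals, so that the case
`b(A_∞) = ∞` means eventually below any level `-N`). -/
theorem persistence_exponent_continuity
    (Ω : ℕ → Type*) [∀ k, MeasurableSpace (Ω k)] (μ : ∀ k, Measure (Ω k))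
    [∀ k, IsProbabilityMeasure (μ k)]
    (Z : ∀ k, ℝ → Ω k → ℝ)
    (Ω' : Type*) [MeasurableSpace Ω'] (μ' : Measure Ω') [IsProbabilityMeasure μ']
    (Zinf : ℝ → Ω' → ℝ)
    (hG : ∀ k, IsCenteredGaussianProcess (μ k) (Z k))
    (hGinf : IsCenteredGaussianProcess μ' Zinf)
    (hcont : ∀ k ω, Continuous fun t => Z k t ω)
    (hcontinf : ∀ ω, Continuous fun t => Zinf t ω)
    (hvar : ∀ k t, (∫ ω, (Z k t ω) ^ 2 ∂(μ k)) = 1)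
    (hvarinf : ∀ t, (∫ ω, (Zinf t ω) ^ 2 ∂μ') = 1)
    (A : ℕ → ℝ → ℝ → ℝ)
    (hA : ∀ k s t, A k s t = ∫ ω, Z k s ω * Z k t ω ∂(μ k))
    (hAnonneg : ∀ k s t, 0 ≤ A k s t)
    (Ainf : ℝ → ℝ → ℝ)
    (hAinf : ∀ s t, Ainf s t = ∫ ω, Zinf s ω * Zinf t ω ∂μ')
    (hAinfnonneg : ∀ s t, 0 ≤ Ainf s t)
    (ρ : ℝ → ℝ) (hstat : ∀ s t, Ainf s t = ρ (t - s))
    -- the persistence exponent `b(A_∞) ∈ [0,∞]` of the limiting process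
    (bA : EReal) (hbA_nonneg : 0 ≤ bA)
    (hbA : Tendsto (fun T : ℝ =>
        (((1 / T) * Real.log
          ((μ' {ω | ∀ t ∈ Icc (0:ℝ) T, Zinf t ω < 0}).toReal) : ℝ) : EReal))
      atTop (nhds (-bA)))
    -- (i) uniform polynomial decay of the auto-correlations
    (hdecay : ∃ η : ℝ, 1 < η ∧ ∃ τ₀ : ℝ, ∃ k₀ : ℕ, ∀ k ≥ k₀, ∀ τ ≥ τ₀, ∀ s : ℝ, 0 ≤ s →
        A k s (s + τ) ≤ τ ^ (-η))
    -- (ii) stability of the persistence exponent of the limiting process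
    (hstab : ∀ η' : ℝ, 0 < η' →
      Filter.limsup (fun M : ℝ =>
          (((1 / M) * Real.log
            ((μ' {ω | ∀ t ∈ Icc (0:ℝ) M, Zinf t ω < M ^ (-η')}).toReal) : ℝ) : EReal))
        atTop = -bA)
    -- (iii) convergence of the maxima probabilities, uniformly over time shifts
    (hconv : ∃ ζ : ℝ, 0 < ζ ∧ ∃ M₁ : ℝ, ∀ z ∈ Icc (0:ℝ) ζ, ∀ M : ℝ, M₁ ≤ M →
      (μ' {ω | ∀ t ∈ Icc (0:ℝ) M, Zinf t ω < z}).toReal ≤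
          Filter.liminf (fun k : ℕ => ⨅ s : Ici (0:ℝ),
            (μ k {ω | ∀ t ∈ Icc (0:ℝ) M, Z k ((s : ℝ) + t) ω < z}).toReal) atTop ∧
        Filter.liminf (fun k : ℕ => ⨅ s : Ici (0:ℝ),
            (μ k {ω | ∀ t ∈ Icc (0:ℝ) M, Z k ((s : ℝ) + t) ω < z}).toReal) atTop ≤
          Filter.limsup (fun k : ℕ => ⨆ s : Ici (0:ℝ),
            (μ k {ω | ∀ t ∈ Icc (0:ℝ) M, Z k ((s : ℝ) + t) ω < z}).toReal) atTop ∧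
        Filter.limsup (fun k : ℕ => ⨆ s : Ici (0:ℝ),
            (μ k {ω | ∀ t ∈ Icc (0:ℝ) M, Z k ((s : ℝ) + t) ω < z}).toReal) atTop ≤
          (μ' {ω | ∀ t ∈ Icc (0:ℝ) M, Zinf t ω ≤ z}).toReal) :
    Tendsto (fun p : ℕ × ℝ =>
        (((1 / p.2) * Real.log
          ((μ p.1 {ω | ∀ t ∈ Icc (0:ℝ) p.2, Z p.1 t ω < 0}).toReal) : ℝ) : EReal))
      (atTop ×ˢ atTop) (nhds (-bA)) := by
  have hAnn : ∀ k s t, 0 ≤ ∫ ω, Z k s ω * Z k t ω ∂(μ k) := fun k s t => hA k s t ▸ hAnonneg k s t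
  have hAinn : ∀ s t, 0 ≤ ∫ ω, Zinf s ω * Zinf t ω ∂μ' := fun s t => hAinf s t ▸ hAinfnonneg s t
  have pk : ∀ k T, 0 < (μ k).real (evs (Z k) (Icc 0 T) 0) := fun k T =>
    evs_pos (μ k) (Z k) (hG k) (hcont k) (hvar k) (hAnn k) _ isCompact_Icc
  have pinf : ∀ T, 0 < μ'.real (evs Zinf (Icc 0 T) 0) := fun T =>
    evs_pos μ' Zinf hGinf hcontinf hvarinf hAinn _ isCompact_Icc
  obtain ⟨ζ, hζ, M₁, hconv⟩ := hconv
  have ev0 : ∀ k T, ((μ k) {ω | ∀ t ∈ Icc (0:ℝ) T, Z k t ω < 0}).toReal =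
    (μ k).real (evs (Z k) (Icc 0 T) 0) := fun _ _ => rfl
  have evi : ∀ M z, (μ' {ω | ∀ t ∈ Icc (0:ℝ) M, Zinf t ω < z}).toReal =
    μ'.real (evs Zinf (Icc 0 M) z) := fun _ _ => rfl
  have evil : ∀ M z, (μ' {ω | ∀ t ∈ Icc (0:ℝ) M, Zinf t ω ≤ z}).toReal =
    μ'.real (evl Zinf (Icc 0 M) z) := fun _ _ => rfl
  have evk : ∀ k s M z, (μ k {ω | ∀ t ∈ Icc (0:ℝ) M, Z k (s + t) ω < z}).toReal =
      (μ k).real (evs (Z k) (Icc s (s + M)) z) := by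
    intro k s M z
    rw [evs_shift]; rfl
  simp only [ev0, evi, evil, evk] at hbA hstab hconv ⊢
  refine tendsto_order.2 ⟨fun a ha => ?_, fun a ha => ?_⟩
  · -- lower bound
    obtain ⟨a0, ha0, ha0'⟩ := EReal.lt_iff_exists_real_btwn.1 ha
    obtain ⟨a', ha1, ha1'⟩ := EReal.lt_iff_exists_real_btwn.1 ha0'
    have haa : a0 < a' := by exact_mod_cast ha1
    have c1 := (tendsto_order.1 hbA).1 _ ha1'
    have c2 : ∀ᶠ M : ℝ in atTop, Real.log 2 / (a' - a0) < M := eventually_gt_atTop _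
    obtain ⟨M, ⟨⟨hM1, hM2⟩, hM3⟩, hM0⟩ :=
      (((c1.and c2).and (eventually_ge_atTop M₁)).and (eventually_gt_atTop 0)).exists
    have hM1' : a' < 1 / M * Real.log (μ'.real (evs Zinf (Icc 0 M) 0)) := by exact_mod_cast hM1
    have hP : Real.exp (a' * M) < μ'.real (evs Zinf (Icc 0 M) 0) := by
      rw [← Real.lt_log_iff_exp_lt (pinf M)]
      rw [one_div, ← div_eq_inv_mul, lt_div_iff₀ hM0] at hM1'
      exact hM1'
    set p := Real.exp (a' * M) / 2 with hp
    have hp0 : 0 < p := by positivity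
    have hlogp : Real.log p = a' * M - Real.log 2 := by
      rw [hp, Real.log_div (Real.exp_pos _).ne' (by norm_num), Real.log_exp]
    have hk : ∀ᶠ k in atTop, p < ⨅ s : Ici (0:ℝ), (μ k).real (evs (Z k) (Icc (s:ℝ) (s + M)) 0) := by
      refine eventually_lt_of_lt_liminf ?_ ?_
      · refine lt_of_lt_of_le ?_ (hconv 0 ⟨le_rfl, hζ.le⟩ M hM3).1
        linarith [Real.exp_pos (a' * M)]
      · refine isBoundedUnder_of ⟨0, fun k => ?_⟩
        exact Real.iInf_nonneg fun s => measureReal_nonneg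
    have hlim : Tendsto (fun T : ℝ => (1 / M + T⁻¹) * Real.log p) atTop
        (nhds ((1 / M + 0) * Real.log p)) :=
      (tendsto_inv_atTop_zero.const_add _).mul_const _
    have hlt : a0 < (1 / M + 0) * Real.log p := by
      rw [hlogp, add_zero, one_div, ← div_eq_inv_mul, lt_div_iff₀ hM0]
      rw [div_lt_iff₀ (by linarith)] at hM2
      nlinarith
    have hT := (hlim.eventually_const_lt hlt).and (eventually_gt_atTop (0:ℝ))
    filter_upwards [(hk.prod_inl (atTop : Filter ℝ)).and (hT.prod_inr (atTop : Filter ℕ))]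
    rintro ⟨k, T⟩ ⟨hk, hT1, hT0⟩
    simp only at hk hT1 hT0 ⊢
    refine ha0.trans ?_
    have hps : ∀ s, 0 ≤ s → p ≤ (μ k).real (evs (Z k) (Icc s (s + M)) 0) := by
      intro s hs
      exact hk.le.trans (ciInf_le (f := fun s : Ici (0:ℝ) =>
        (μ k).real (evs (Z k) (Icc (s:ℝ) (s + M)) 0))
        ⟨0, by rintro _ ⟨s, rfl⟩; exact measureReal_nonneg⟩ ⟨s, hs⟩)
    have hp1 : p ≤ 1 := (hps 0 le_rfl).trans measureReal_le_one
    have hlogp0 : Real.log p ≤ 0 := Real.log_nonpos hp0.le hp1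
    have hl := lower_T (μ k) (Z k) (hG k) (hcont k) (hAnn k) M T p hM0 hT0 hp0.le hps ⌈T / M⌉₊
      (by rw [← div_le_iff₀ hM0]; exact Nat.le_ceil _)
    have hlog := Real.log_le_log (by positivity) hl
    rw [Real.log_pow] at hlog
    have hceil : (⌈T / M⌉₊ : ℝ) ≤ T / M + 1 := (Nat.ceil_lt_add_one (by positivity)).le
    have h2 : (T / M + 1) * Real.log p ≤ Real.log ((μ k).real (evs (Z k) (Icc 0 T) 0)) :=
      (mul_le_mul_of_nonpos_right hceil hlogp0).trans hlog
    have h3 : a0 < 1 / T * Real.log ((μ k).real (evs (Z k) (Icc 0 T) 0)) := by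
      refine hT1.trans_le ?_
      have e : (1 / M + T⁻¹) * Real.log p = 1 / T * ((T / M + 1) * Real.log p) := by
        field_simp
      rw [e]
      gcongr
    exact_mod_cast h3
  · -- upper bound
    have hneg : ∀ k T, Real.log ((μ k).real (evs (Z k) (Icc 0 T) 0)) ≤ 0 := fun k T =>
      Real.log_nonpos measureReal_nonneg measureReal_le_one
    rcases lt_or_ge 0 a with hapos | hale
    · have hT := eventually_gt_atTop (0:ℝ)
      filter_upwards [hT.prod_inr (atTop : Filter ℕ)]
      rintro ⟨k, T⟩ hT0
      refine lt_of_le_of_lt ?_ hapos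
      have : 1 / T * Real.log ((μ k).real (evs (Z k) (Icc 0 T) 0)) ≤ 0 :=
        mul_nonpos_of_nonneg_of_nonpos (by simp only at hT0; positivity) (hneg k T)
      exact_mod_cast this
    obtain ⟨a1, ha1, ha1'⟩ := EReal.lt_iff_exists_real_btwn.1 ha
    obtain ⟨a', ha2, ha2'⟩ := EReal.lt_iff_exists_real_btwn.1 ha1
    have haa : a' < a1 := by exact_mod_cast ha2'
    have ha10 : a1 < 0 := by exact_mod_cast ha1'.trans_le hale
    obtain ⟨δ, hδ0, hδ⟩ : ∃ δ : ℝ, 0 < δ ∧ a' < a1 * (1 + δ) := by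
      refine ⟨(a1 - a') / (-a1) / 2, ?_, ?_⟩
      · exact div_pos (div_pos (by linarith) (by linarith)) (by norm_num)
      · have : a1 * (1 + (a1 - a') / (-a1) / 2) = a1 - (a1 - a') / 2 := by
          have hne : a1 ≠ 0 := ha10.ne
          field_simp
          ring
        rw [this]; linarith
    obtain ⟨η, hη, τ₀, k₀, hdec⟩ := hdecay
    set S1 := ∑' m : ℤ, |(m:ℝ)| ^ (-η) with hS1
    have hsum : Summable fun m : ℤ => |(m:ℝ)| ^ (-η) := Real.summable_abs_int_rpow hη
    have hS1pos : 0 < S1 := hsum.tsum_pos (fun m => by positivity) 1 (by simp)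
    set η' := (η - 1) / 4 with hη'
    have hη'0 : 0 < η' := by rw [hη']; linarith
    have c1 : ∀ᶠ M : ℝ in atTop, (((1 / M) * Real.log
        (μ'.real (evs Zinf (Icc 0 M) (M ^ (-η')))) : ℝ) : EReal) < a' := by
      refine eventually_lt_of_limsup_lt ?_
      rw [hstab η' hη'0]; exact ha2
    have c2 : ∀ᶠ M : ℝ in atTop, S1 * (δ * M) ^ (-η) < 1 / 2 := by
      have : Tendsto (fun M : ℝ => S1 * (δ * M) ^ (-η)) atTop (nhds (S1 * 0)) :=
        ((tendsto_rpow_neg_atTop (by linarith : 0 < η)).comp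
          (tendsto_id.const_mul_atTop hδ0)).const_mul S1
      rw [mul_zero] at this
      exact this.eventually_lt_const (by norm_num)
    have c3 : ∀ᶠ M : ℝ in atTop, M ^ (-η') < ζ :=
      (tendsto_rpow_neg_atTop hη'0).eventually_lt_const hζ
    have c4 : ∀ᶠ M : ℝ in atTop, (-a') * (256 * S1 * δ ^ (-η)) ≤ M ^ (2 * η') :=
      (tendsto_rpow_atTop (by linarith : 0 < 2 * η')).eventually_ge_atTop _
    have c5 : ∀ᶠ M : ℝ in atTop, Real.log 2 / (a1 * (1 + δ) - a') < M := eventually_gt_atTop _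
    have c6 : ∀ᶠ M : ℝ in atTop, τ₀ / δ ≤ M := eventually_ge_atTop _
    obtain ⟨M, ⟨⟨⟨⟨⟨⟨⟨hM1, hM2⟩, hM3⟩, hM4⟩, hM5⟩, hM6⟩, hM7⟩, hM0⟩⟩ :=
      (((((((c1.and c2).and c3).and c4).and c5).and c6).and (eventually_ge_atTop M₁)).and
        (eventually_gt_atTop (0:ℝ))).exists
    set w := M ^ (-η') with hw
    have hw0 : 0 < w := Real.rpow_pos_of_pos hM0 _
    set γ := S1 * (δ * M) ^ (-η) with hγ
    have hγ0 : 0 < γ := by positivity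
    have hPw : μ'.real (evs Zinf (Icc 0 M) w) < Real.exp (a' * M) := by
      have hpos : 0 < μ'.real (evs Zinf (Icc 0 M) w) :=
        (pinf M).trans_le (measureReal_mono fun ω hω t ht => (hω t ht).trans hw0)
      rw [← Real.log_lt_iff_lt_exp hpos]
      have hM1' : 1 / M * Real.log (μ'.real (evs Zinf (Icc 0 M) w)) < a' := by exact_mod_cast hM1
      rwa [one_div, ← div_eq_inv_mul, div_lt_iff₀ hM0] at hM1'
    have hk : ∀ᶠ k in atTop, ⨆ s : Ici (0:ℝ), (μ k).real (evs (Z k) (Icc (s:ℝ) (s + M)) (w / 2)) <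
        Real.exp (a' * M) := by
      refine eventually_lt_of_limsup_lt ?_ ?_
      · refine lt_of_le_of_lt (hconv (w / 2) ⟨by positivity, by linarith⟩ M hM7).2.2 ?_
        have hsub : evl Zinf (Icc 0 M) (w / 2) ⊆ evs Zinf (Icc 0 M) w :=
          fun ω hω t ht => (hω t ht).trans_lt (by linarith)
        exact (measureReal_mono hsub).trans_lt hPw
      · refine isBoundedUnder_of ⟨1, fun k => ?_⟩
        exact ciSup_le fun s => measureReal_le_one
    set z := w / 8 with hz
    have hz0 : 0 < z := by positivity
    have hq : Real.exp (-(z ^ 2 / (4 * γ))) ≤ Real.exp (a' * M) := by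
      refine Real.exp_le_exp.2 ?_
      have e1 : z ^ 2 = M ^ (-(2 * η')) / 64 := by
        rw [hz, hw, div_pow, ← Real.rpow_natCast, ← Real.rpow_mul hM0.le]
        norm_num; ring_nf
      have e2 : γ = S1 * δ ^ (-η) * M ^ (-η) := by
        rw [hγ, Real.mul_rpow hδ0.le hM0.le]; ring
      have e3 : M ^ (-(2 * η')) = M ^ (2 * η') * M ^ (-η) * M := by
        rw [← Real.rpow_add hM0, ← Real.rpow_add_one hM0.ne']
        congr 1
        rw [hη']; ring
      have hd : 0 < δ ^ (-η) := Real.rpow_pos_of_pos hδ0 _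
      have hMη : 0 < M ^ (-η) := Real.rpow_pos_of_pos hM0 _
      have : -a' * M ≤ z ^ 2 / (4 * γ) := by
        rw [le_div_iff₀ (by positivity), e1, e3, e2]
        have := mul_le_mul_of_nonneg_right hM4 (by positivity : 0 ≤ M ^ (-η) * M / 64)
        nlinarith
      linarith
    have hzc : z / Real.sqrt (1 - γ) < w / 2 := by
      have h1 : (1:ℝ) / 2 ≤ Real.sqrt (1 - γ) := by
        refine Real.le_sqrt_of_sq_le ?_
        linarith
      rw [div_lt_iff₀ (by linarith)]
      nlinarith
    set L := Real.log 2 + a' * M with hL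
    set D := M + δ * M with hD
    have hD0 : 0 < D := by positivity
    have hLD : L < a1 * D := by
      rw [div_lt_iff₀ (by linarith)] at hM5
      rw [hL, hD]
      nlinarith
    have hL0 : L < 0 := by nlinarith
    have hlim : Tendsto (fun T : ℝ => (1 / D - T⁻¹) * L) atTop (nhds ((1 / D - 0) * L)) :=
      (tendsto_inv_atTop_zero.const_sub _).mul_const _
    have hlt : (1 / D - 0) * L < a1 := by
      rw [sub_zero, one_div, ← div_eq_inv_mul, div_lt_iff₀ hD0]
      exact hLD
    have hT := (hlim.eventually_lt_const hlt).and (eventually_gt_atTop (0:ℝ))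
    filter_upwards [((hk.and (eventually_ge_atTop k₀)).prod_inl (atTop : Filter ℝ)).and
      (hT.prod_inr (atTop : Filter ℕ))]
    rintro ⟨k, T⟩ ⟨⟨hk, hkk⟩, hT1, hT0⟩
    simp only at hk hkk hT1 hT0 ⊢
    refine lt_trans ?_ ha1'
    have hps : ∀ s, 0 ≤ s → (μ k).real (evl (Z k) (Icc s (s + M)) (z / Real.sqrt (1 - γ))) ≤
        Real.exp (a' * M) := by
      intro s hs
      refine le_trans (measureReal_mono fun ω hω t ht => (hω t ht).trans_lt hzc) (le_trans ?_ hk.le)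
      exact le_ciSup (f := fun s : Ici (0:ℝ) =>
        (μ k).real (evs (Z k) (Icc (s:ℝ) (s + M)) (w / 2)))
        ⟨1, by rintro _ ⟨s, rfl⟩; exact measureReal_le_one⟩ ⟨s, hs⟩
    have hu := upper_T (μ k) (Z k) (hG k) (hcont k) (hvar k) η M (δ * M) T z γ (Real.exp (a' * M)) hη hM0
      (by positivity) hz0 hγ hγ0 (by linarith)
      (fun τ hτ s hs => by
        rw [← hA]
        refine hdec k hkk τ (le_trans ?_ hτ) s hs
        rw [div_le_iff₀ hδ0] at hM6; linarith)
      hps ⌊T / D⌋₊ (by rw [← le_div_iff₀ hD0]; exact Nat.floor_le (by positivity))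
    have hu2 : (μ k).real (evs (Z k) (Icc 0 T) 0) ≤ (2 * Real.exp (a' * M)) ^ ⌊T / D⌋₊ :=
      hu.trans (pow_le_pow_left₀ (by positivity) (by linarith) _)
    have hlog := Real.log_le_log (pk k T) hu2
    rw [Real.log_pow, Real.log_mul (by norm_num) (Real.exp_pos _).ne', Real.log_exp, ← hL] at hlog
    have hfl : T / D - 1 ≤ (⌊T / D⌋₊ : ℝ) := (Nat.sub_one_lt_floor _).le
    have h2 : Real.log ((μ k).real (evs (Z k) (Icc 0 T) 0)) ≤ (T / D - 1) * L :=
      hlog.trans (mul_le_mul_of_nonpos_right hfl hL0.le)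
    have h3 : 1 / T * Real.log ((μ k).real (evs (Z k) (Icc 0 T) 0)) < a1 := by
      refine lt_of_le_of_lt ?_ hT1
      have e : (1 / D - T⁻¹) * L = 1 / T * ((T / D - 1) * L) := by
        field_simp
      rw [e]
      gcongr
    exact_mod_cast h3
end
end

section
/- For every d ≥ 1 there exists a finite constant K_d, depending only on d, with the following property: for any a < b, any M < ∞ and any centered Gaussian process {Z_t}_{t ∈ [a,b]^d} with continuous sample paths satisfying E[(Z_t − Z_s)²] ≤ M² ‖t − s‖² for all s, t ∈ [a,b]^d (Euclidean norm), one has E[ sup_{t ∈ [a,b]^d} Z_t ] ≤ K_d · M · (b − a). -/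
open MeasureTheory ProbabilityTheory Filter Set

noncomputable section

lemma gauss_aemeas {Ω : Type*} [MeasurableSpace Ω] {μ : Measure Ω} {X : Ω → ℝ}
    (h : IsCenteredGaussian μ X) : AEMeasurable X μ := by
  obtain ⟨v, hv⟩ := h
  by_contra hn
  rw [Measure.map_of_not_aemeasurable hn] at hv
  exact IsProbabilityMeasure.ne_zero (gaussianReal 0 v) hv.symm

lemma gauss_integrable {Ω : Type*} [MeasurableSpace Ω] {μ : Measure Ω} {X : Ω → ℝ}
    (h : IsCenteredGaussian μ X) : Integrable X μ ∧ ∫ ω, X ω ∂μ = 0 := by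
  have hm := gauss_aemeas h
  obtain ⟨v, hv⟩ := h
  constructor
  · have h1 : Integrable (id : ℝ → ℝ) (Measure.map X μ) := by
      rw [hv]; exact (memLp_id_gaussianReal 1).integrable (by norm_num)
    exact (integrable_map_measure h1.aestronglyMeasurable hm).1 h1
  · have := integral_map (f := (fun x : ℝ => x)) hm (by fun_prop)
    rw [← this, hv, integral_id_gaussianReal]

lemma gauss_exp_s17 {Ω : Type*} [MeasurableSpace Ω] {μ : Measure Ω} {X : Ω → ℝ}
    (h : IsCenteredGaussian μ X) {σ : ℝ} (hσ : 0 < σ) (hX : ∫ ω, X ω ^ 2 ∂μ ≤ σ ^ 2) :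
    Integrable (fun ω => Real.exp (X ω / σ)) μ ∧ ∫ ω, Real.exp (X ω / σ) ∂μ ≤ 2 := by
  have hm := gauss_aemeas h
  obtain ⟨v, hv⟩ := h
  have hvar : (v : ℝ) ≤ σ ^ 2 := by
    have h1 := integral_map (f := (fun x : ℝ => x ^ 2)) hm (by fun_prop)
    rw [← h1, hv] at hX
    have h2 : Var[fun x : ℝ => x; gaussianReal 0 v] = v := variance_fun_id_gaussianReal
    rw [variance_eq_integral (by fun_prop)] at h2
    simp only [integral_id_gaussianReal, sub_zero] at h2
    linarith
  have hi : Integrable (fun x => Real.exp (σ⁻¹ * x)) (Measure.map X μ) := by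
    rw [hv]; exact integrable_exp_mul_gaussianReal _
  have he : (fun ω => Real.exp (X ω / σ)) = (fun x => Real.exp (σ⁻¹ * x)) ∘ X := by
    funext ω; simp [div_eq_inv_mul]
  constructor
  · rw [he]
    exact (integrable_map_measure hi.aestronglyMeasurable hm).1 hi
  · have h1 := integral_map (f := (fun x => Real.exp (σ⁻¹ * x))) hm hi.aestronglyMeasurable
    have h2 : ∫ ω, Real.exp (X ω / σ) ∂μ = mgf id (gaussianReal 0 v) σ⁻¹ := by
      rw [mgf, ← hv]
      simp only [id]
      rw [h1]
      simp [div_eq_inv_mul]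
    rw [h2, congrFun mgf_id_gaussianReal σ⁻¹]
    have h3 : 0 * σ⁻¹ + (v : ℝ) * σ⁻¹ ^ 2 / 2 ≤ 1 / 2 := by
      have : (v : ℝ) * σ⁻¹ ^ 2 ≤ 1 := by
        rw [inv_pow, ← div_eq_mul_inv, div_le_one (by positivity)]; exact hvar
      linarith
    refine (Real.exp_le_exp.2 h3).trans ?_
    have h4 : Real.exp (1 / 2) ^ 2 = Real.exp 1 := by
      rw [← Real.exp_nat_mul]; norm_num
    have := Real.exp_one_lt_d9
    nlinarith [Real.exp_pos (1 / 2 : ℝ)]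

/-- Dyadic grid points of the cube. -/
def gpt {d : ℕ} (a b : ℝ) (n : ℕ) (k : Fin d → ℕ) : Fin d → ℝ :=
  fun i => a + (b - a) * ((k i : ℝ) / 2 ^ n)

/-- Increment of the process along an edge of the dyadic tree. -/
def ginc {d : ℕ} {Ω : Type*} (Z : (Fin d → ℝ) → Ω → ℝ) (a b : ℝ) (m : ℕ) (k : Fin d → ℕ)
    (ω : Ω) : ℝ :=
  Z (gpt a b (m + 1) k) ω - Z (gpt a b m (fun i => k i / 2)) ω

/-- Bound for all increments at a given level. -/
def glev {d : ℕ} {Ω : Type*} (Z : (Fin d → ℝ) → Ω → ℝ) (a b : ℝ) (σ L : ℝ) (m : ℕ)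
    (ω : Ω) : ℝ :=
  σ * (L + Real.exp (-L) * ∑ k : Fin d → Fin (2 ^ (m + 1)),
    Real.exp (ginc Z a b m (fun i => (k i : ℕ)) ω / σ))

lemma gpt_mem {d : ℕ} {a b : ℝ} (hab : a < b) (n : ℕ) (k : Fin d → ℕ) (hk : ∀ i, k i < 2 ^ n) :
    gpt a b n k ∈ Icc (fun _ => a) (fun _ => b) := by
  have h0 : ∀ i, (0 : ℝ) ≤ (k i : ℝ) / 2 ^ n := fun i => by positivity
  have h1 : ∀ i, (k i : ℝ) / 2 ^ n ≤ 1 := fun i => by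
    rw [div_le_one (by positivity)]
    exact_mod_cast (hk i).le
  constructor
  · intro i
    simp only [gpt]
    nlinarith [h0 i]
  · intro i
    simp only [gpt]
    nlinarith [h1 i]

lemma glev_nonneg {d : ℕ} {Ω : Type*} (Z : (Fin d → ℝ) → Ω → ℝ) (a b : ℝ) {σ L : ℝ}
    (hσ : 0 < σ) (hL : 0 ≤ L) (m : ℕ) (ω : Ω) : 0 ≤ glev Z a b σ L m ω := by
  unfold glev; positivity

lemma ginc_le {d : ℕ} {Ω : Type*} (Z : (Fin d → ℝ) → Ω → ℝ) (a b : ℝ) {σ L : ℝ}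
    (hσ : 0 < σ) (m : ℕ) (ω : Ω) (k : Fin d → ℕ) (hk : ∀ i, k i < 2 ^ (m + 1)) :
    ginc Z a b m k ω ≤ glev Z a b σ L m ω := by
  unfold glev
  have h1 : Real.exp (ginc Z a b m k ω / σ) ≤ ∑ k : Fin d → Fin (2 ^ (m + 1)),
      Real.exp (ginc Z a b m (fun i => (k i : ℕ)) ω / σ) := by
    obtain ⟨k', hk'⟩ : ∃ k' : Fin d → Fin (2 ^ (m + 1)), (fun i => (k' i : ℕ)) = k :=
      ⟨fun i => ⟨k i, hk i⟩, rfl⟩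
    rw [← hk']
    generalize hf : (fun k : Fin d → Fin (2 ^ (m + 1)) =>
      Real.exp (ginc Z a b m (fun i => (k i : ℕ)) ω / σ)) = f
    have hf0 : ∀ k, 0 ≤ f k := fun k => by rw [← hf]; exact (Real.exp_pos _).le
    have h3 := Finset.single_le_sum (fun k _ => hf0 k) (Finset.mem_univ k')
    refine le_trans (le_of_eq ?_) h3
    rw [← hf]
  have h2 : ginc Z a b m k ω / σ ≤ L + Real.exp (-L) * Real.exp (ginc Z a b m k ω / σ) := by
    rw [← Real.exp_add]
    have := Real.add_one_le_exp (-L + ginc Z a b m k ω / σ)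
    linarith
  rw [div_le_iff₀ hσ, mul_comm] at h2
  refine h2.trans ?_
  gcongr

lemma grid_le {d : ℕ} {Ω : Type*} (Z : (Fin d → ℝ) → Ω → ℝ) (a b : ℝ) {σ L : ℕ → ℝ}
    (hσ : ∀ m, 0 < σ m) (ω : Ω) (n : ℕ) :
    ∀ k : Fin d → ℕ, (∀ i, k i < 2 ^ n) →
    Z (gpt a b n k) ω - Z (fun _ => a) ω ≤ ∑ m ∈ Finset.range n, glev Z a b (σ m) (L m) m ω := by
  induction n with
  | zero =>
    intro k hk
    have : gpt a b 0 k = fun _ => a := by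
      funext i
      have : k i = 0 := by simpa using hk i
      simp [gpt, this]
    simp [this]
  | succ n ih =>
    intro k hk
    rw [Finset.sum_range_succ]
    have h1 := ih (fun i => k i / 2) (fun i => by have := hk i; rw [pow_succ] at this; omega)
    have h2 := ginc_le (L := L n) Z a b (hσ n) n ω k hk
    unfold ginc at h2
    linarith

lemma cube_le {d : ℕ} {Ω : Type*} (Z : (Fin d → ℝ) → Ω → ℝ) {a b : ℝ} (hab : a < b)
    (ω : Ω) (hc : Continuous fun t => Z t ω) (B : ENNReal)
    (hB : ∀ n, ∀ k : Fin d → ℕ, (∀ i, k i < 2 ^ n) →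
      ENNReal.ofReal (Z (gpt a b n k) ω - Z (fun _ => a) ω) ≤ B)
    (t : Fin d → ℝ) (ht : t ∈ Icc (fun _ => a) (fun _ => b)) :
    ENNReal.ofReal (Z t ω - Z (fun _ => a) ω) ≤ B := by
  have hba : 0 < b - a := sub_pos.2 hab
  let u : Fin d → ℝ := fun i => (t i - a) / (b - a)
  have hu0 : ∀ i, 0 ≤ u i := fun i => div_nonneg (sub_nonneg.2 (ht.1 i)) hba.le
  have hu1 : ∀ i, u i ≤ 1 := fun i => by
    have := ht.2 i
    simp only [u]
    rw [div_le_one hba]; linarith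
  let k : ℕ → Fin d → ℕ := fun n i => ⌈2 ^ n * u i⌉₊ - 1
  have hk : ∀ n i, k n i < 2 ^ n := fun n i => by
    have h1 : ⌈2 ^ n * u i⌉₊ ≤ 2 ^ n := by
      apply Nat.ceil_le.2
      push_cast
      have : (0 : ℝ) < 2 ^ n := by positivity
      nlinarith [hu1 i]
    have h2 : 0 < 2 ^ n := by positivity
    simp only [k]
    omega
  have happ : ∀ n i, |(k n i : ℝ) / 2 ^ n - u i| ≤ (1 / 2) ^ n := fun n i => by
    have hp : (0 : ℝ) < 2 ^ n := by positivity
    have hx : 0 ≤ 2 ^ n * u i := mul_nonneg hp.le (hu0 i)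
    have h1 := Nat.le_ceil (2 ^ n * u i)
    have h2 := Nat.ceil_lt_add_one hx
    have h3 : |(k n i : ℝ) - 2 ^ n * u i| ≤ 1 := by
      simp only [k]
      rcases Nat.eq_zero_or_pos ⌈2 ^ n * u i⌉₊ with h | h
      · rw [h] at h1 ⊢
        have : 2 ^ n * u i = 0 := le_antisymm (by simpa using h1) hx
        simp [this]
      · rw [Nat.cast_sub h, abs_le]
        constructor <;> push_cast <;> linarith
    have h4 : (k n i : ℝ) / 2 ^ n - u i = ((k n i : ℝ) - 2 ^ n * u i) / 2 ^ n := by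
      field_simp
    rw [h4, abs_div, abs_of_pos hp, one_div_pow]
    gcongr
  have hlim : Tendsto (fun n => gpt a b n (k n)) atTop (nhds t) := by
    rw [tendsto_pi_nhds]
    intro i
    have h1 : Tendsto (fun n => (k n i : ℝ) / 2 ^ n) atTop (nhds (u i)) := by
      rw [tendsto_iff_norm_sub_tendsto_zero]
      refine squeeze_zero (fun _ => norm_nonneg _) (fun n => happ n i) ?_
      exact tendsto_pow_atTop_nhds_zero_of_lt_one (by norm_num) (by norm_num)
    have h2 := (h1.const_mul (b - a)).const_add a
    have h3 : a + (b - a) * u i = t i := by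
      simp only [u]; field_simp; ring
    rw [h3] at h2
    exact h2
  have hl2 : Tendsto (fun n => ENNReal.ofReal (Z (gpt a b n (k n)) ω - Z (fun _ => a) ω)) atTop
      (nhds (ENNReal.ofReal (Z t ω - Z (fun _ => a) ω))) :=
    ENNReal.tendsto_ofReal (((hc.tendsto t).comp hlim).sub_const _)
  exact le_of_tendsto' hl2 (fun n => hB n (k n) (hk n))

/-- The level constants. -/
def gcst (d m : ℕ) : ℝ := d / 2 ^ (m + 1) * ((m + 1) * d + 2)

lemma gcst_nonneg (d m : ℕ) : 0 ≤ gcst d m := by unfold gcst; positivity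

lemma gcst_summable (d : ℕ) : Summable (gcst d) := by
  have h1 := summable_pow_mul_geometric_of_norm_lt_one (R := ℝ) 1 (r := 1 / 2)
    (by norm_num)
  have h0 := summable_pow_mul_geometric_of_norm_lt_one (R := ℝ) 0 (r := 1 / 2)
    (by norm_num)
  refine ((h1.mul_left ((d : ℝ) * d / 2)).add (h0.mul_left ((d : ℝ) * (d + 2) / 2))).congr ?_
  intro m
  simp only [gcst, one_div_pow]
  field_simp
  ring

lemma ginc_gauss {d : ℕ} {Ω : Type*} [MeasurableSpace Ω] {μ : Measure Ω}
    {Z : (Fin d → ℝ) → Ω → ℝ} (hZ : IsCenteredGaussianProcess μ Z) (a b : ℝ) (m : ℕ)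
    (k : Fin d → ℕ) : IsCenteredGaussian μ (ginc Z a b m k) := by
  have := hZ 2 ![1, -1] ![gpt a b (m + 1) k, gpt a b m (fun i => k i / 2)]
  convert this using 2 with ω
  simp [ginc, Fin.sum_univ_two]
  ring

lemma glev_lint {d : ℕ} (hd : 1 ≤ d) {a b M : ℝ} (hab : a < b) (hM : 0 < M)
    {Ω : Type*} [MeasurableSpace Ω] {μ : Measure Ω} [IsProbabilityMeasure μ]
    {Z : (Fin d → ℝ) → Ω → ℝ} (hZ : IsCenteredGaussianProcess μ Z)
    (hinc : ∀ s t : Fin d → ℝ, s ∈ Icc (fun _ => a) (fun _ => b) →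
          t ∈ Icc (fun _ => a) (fun _ => b) →
          (∫ ω, (Z t ω - Z s ω) ^ 2 ∂μ) ≤ M ^ 2 * ∑ i, (t i - s i) ^ 2) (m : ℕ) :
    AEMeasurable (fun ω => ENNReal.ofReal
      (glev Z a b (M * (b - a) * d / 2 ^ (m + 1)) ((m + 1) * d) m ω)) μ ∧
    ∫⁻ ω, ENNReal.ofReal (glev Z a b (M * (b - a) * d / 2 ^ (m + 1)) ((m + 1) * d) m ω) ∂μ
      ≤ ENNReal.ofReal (gcst d m * (M * (b - a))) := by
  have hba : 0 < b - a := sub_pos.2 hab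
  have hd1 : (1 : ℝ) ≤ d := by exact_mod_cast hd
  have hd0 : (0 : ℝ) < d := by linarith
  set σ : ℝ := M * (b - a) * d / 2 ^ (m + 1) with hσd
  set L : ℝ := (m + 1) * d with hLd
  have hσ : 0 < σ := by positivity
  have hL : 0 ≤ L := by positivity
  have hk : ∀ k : Fin d → Fin (2 ^ (m + 1)),
      Integrable (fun ω => Real.exp (ginc Z a b m (fun i => (k i : ℕ)) ω / σ)) μ ∧
      ∫ ω, Real.exp (ginc Z a b m (fun i => (k i : ℕ)) ω / σ) ∂μ ≤ 2 := by
    intro k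
    refine gauss_exp_s17 (ginc_gauss hZ a b m _) hσ ?_
    unfold ginc
    refine (hinc _ _ (gpt_mem hab m _ ?_) (gpt_mem hab (m + 1) _ fun i => (k i).2)).trans ?_
    · intro i
      have h0 : (k i : ℕ) < 2 ^ m * 2 := (k i).2.trans_eq (pow_succ 2 m)
      show (k i : ℕ) / 2 < 2 ^ m
      omega
    · have h1 : ∀ i : Fin d, (gpt a b (m + 1) (fun i => (k i : ℕ)) i
          - gpt a b m (fun i => (k i : ℕ) / 2) i) ^ 2 ≤ ((b - a) / 2 ^ (m + 1)) ^ 2 := by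
        intro i
        have h2 : ((k i : ℕ) : ℝ) = 2 * (((k i : ℕ) / 2 : ℕ) : ℝ) + (((k i : ℕ) % 2 : ℕ) : ℝ) := by
          exact_mod_cast (Nat.div_add_mod (k i : ℕ) 2).symm
        have h3 : ((((k i : ℕ) % 2 : ℕ) : ℝ)) ≤ 1 := by
          have : (k i : ℕ) % 2 ≤ 1 := by omega
          exact_mod_cast this
        have h4 : gpt a b (m + 1) (fun i => (k i : ℕ)) i
          - gpt a b m (fun i => (k i : ℕ) / 2) i
            = (b - a) / 2 ^ (m + 1) * (((k i : ℕ) % 2 : ℕ) : ℝ) := by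
          simp only [gpt]
          rw [h2, show (2 : ℝ) ^ (m + 1) = 2 ^ m * 2 from pow_succ 2 m]
          field_simp
          ring
        rw [h4]
        have h5 : (b - a) / 2 ^ (m + 1) * (((k i : ℕ) % 2 : ℕ) : ℝ) ≤ (b - a) / 2 ^ (m + 1) :=
          mul_le_of_le_one_right (by positivity) h3
        exact pow_le_pow_left₀ (by positivity) h5 2
      have h6 := Finset.sum_le_sum (fun i (_ : i ∈ (Finset.univ : Finset (Fin d))) => h1 i)
      rw [Finset.sum_const, Finset.card_univ, Fintype.card_fin, nsmul_eq_mul] at h6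
      refine (mul_le_mul_of_nonneg_left h6 (sq_nonneg M)).trans ?_
      have h7 : σ ^ 2 = M ^ 2 * ((d : ℝ) ^ 2 * ((b - a) / 2 ^ (m + 1)) ^ 2) := by
        rw [hσd]; ring
      rw [h7]
      gcongr
      nlinarith
  have hsum : Integrable (fun ω => ∑ k : Fin d → Fin (2 ^ (m + 1)),
      Real.exp (ginc Z a b m (fun i => (k i : ℕ)) ω / σ)) μ :=
    integrable_finsetSum _ fun k _ => (hk k).1
  have hglev_int : Integrable (glev Z a b σ L m) μ := by
    unfold glev
    exact ((integrable_const L).add (hsum.const_mul _)).const_mul σ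
  refine ⟨hglev_int.aestronglyMeasurable.aemeasurable.ennreal_ofReal, ?_⟩
  rw [← ofReal_integral_eq_lintegral_ofReal hglev_int (ae_of_all _ fun ω => glev_nonneg Z a b hσ hL m ω)]
  apply ENNReal.ofReal_le_ofReal
  have hE : ∫ ω, glev Z a b σ L m ω ∂μ = σ * (L + Real.exp (-L) *
      ∑ k : Fin d → Fin (2 ^ (m + 1)),
        ∫ ω, Real.exp (ginc Z a b m (fun i => (k i : ℕ)) ω / σ) ∂μ) := by
    unfold glev
    rw [integral_const_mul, integral_add (integrable_const L) (hsum.const_mul _),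
      integral_const_mul (Real.exp (-L)), integral_finsetSum _ fun k _ => (hk k).1]
    simp
  have hN : ∑ k : Fin d → Fin (2 ^ (m + 1)),
        ∫ ω, Real.exp (ginc Z a b m (fun i => (k i : ℕ)) ω / σ) ∂μ ≤ Real.exp L * 2 := by
    refine (Finset.sum_le_sum fun k _ => (hk k).2).trans ?_
    rw [Finset.sum_const, Finset.card_univ, Fintype.card_fun, Fintype.card_fin, Fintype.card_fin,
      nsmul_eq_mul]
    gcongr
    have h8 : Real.exp L = Real.exp 1 ^ ((m + 1) * d) := by
      rw [← Real.exp_nat_mul, hLd]; push_cast; simp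
    rw [h8, ← pow_mul]
    push_cast
    gcongr
    have := Real.add_one_le_exp (1 : ℝ)
    linarith
  have hN2 : Real.exp (-L) * ∑ k : Fin d → Fin (2 ^ (m + 1)),
        ∫ ω, Real.exp (ginc Z a b m (fun i => (k i : ℕ)) ω / σ) ∂μ ≤ 2 := by
    refine (mul_le_mul_of_nonneg_left hN (Real.exp_pos _).le).trans ?_
    rw [← mul_assoc, ← Real.exp_add]; simp
  rw [hE]
  have h9 : gcst d m * (M * (b - a)) = σ * (L + 2) := by
    rw [gcst, hσd, hLd]; ring
  rw [h9]
  gcongr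

lemma main_pos {d : ℕ} (hd : 1 ≤ d) {a b M : ℝ} (hab : a < b) (hM : 0 < M)
    {Ω : Type*} [MeasurableSpace Ω] {μ : Measure Ω} [IsProbabilityMeasure μ]
    {Z : (Fin d → ℝ) → Ω → ℝ} (hZ : IsCenteredGaussianProcess μ Z)
    (hc : ∀ ω, Continuous fun t => Z t ω)
    (hinc : ∀ s t : Fin d → ℝ, s ∈ Icc (fun _ => a) (fun _ => b) →
          t ∈ Icc (fun _ => a) (fun _ => b) →
          (∫ ω, (Z t ω - Z s ω) ^ 2 ∂μ) ≤ M ^ 2 * ∑ i, (t i - s i) ^ 2) :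
    (∫ ω, (⨆ p : (Icc (fun _ => a) (fun _ => b) : Set (Fin d → ℝ)), Z p.1 ω) ∂μ) ≤
          (∑' m, gcst d m) * M * (b - a) := by
  have hba : 0 < b - a := sub_pos.2 hab
  have hd0 : (0 : ℝ) < d := by exact_mod_cast hd
  have hR : 0 ≤ (∑' m, gcst d m) * M * (b - a) :=
    mul_nonneg (mul_nonneg (tsum_nonneg (gcst_nonneg d)) hM.le) hba.le
  by_cases hi : Integrable
      (fun ω => ⨆ p : (Icc (fun _ => a) (fun _ => b) : Set (Fin d → ℝ)), Z p.1 ω) μ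
  swap
  · rw [integral_undef hi]; exact hR
  have ha : (fun _ => a) ∈ (Icc (fun _ => a) (fun _ => b) : Set (Fin d → ℝ)) :=
    ⟨le_rfl, fun _ => hab.le⟩
  have hsup : ∀ ω, ∃ t ∈ (Icc (fun _ => a) (fun _ => b) : Set (Fin d → ℝ)),
      (⨆ p : (Icc (fun _ => a) (fun _ => b) : Set (Fin d → ℝ)), Z p.1 ω) = Z t ω ∧
      Z (fun _ => a) ω ≤ Z t ω := by
    intro ω
    obtain ⟨t, ht, hmax⟩ := (isCompact_Icc (a := (fun _ : Fin d => a)) (b := fun _ => b)).exists_isMaxOn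
      ⟨_, ha⟩ (hc ω).continuousOn
    refine ⟨t, ht, ?_, hmax ha⟩
    have : Nonempty (Icc (fun _ => a) (fun _ => b) : Set (Fin d → ℝ)) := ⟨⟨_, ha⟩⟩
    refine le_antisymm (ciSup_le fun p => hmax p.2) ?_
    refine le_ciSup (f := fun p : (Icc (fun _ => a) (fun _ => b) : Set (Fin d → ℝ)) => Z p.1 ω)
      ⟨Z t ω, ?_⟩ ⟨t, ht⟩
    rintro _ ⟨p, rfl⟩
    exact hmax p.2
  have hZa : Integrable (Z (fun _ => a)) μ ∧ ∫ ω, Z (fun _ => a) ω ∂μ = 0 := by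
    apply gauss_integrable
    have := hZ 1 ![1] ![fun _ => a]
    simpa using this
  set S : Ω → ℝ := fun ω => ⨆ p : (Icc (fun _ => a) (fun _ => b) : Set (Fin d → ℝ)), Z p.1 ω
    with hS
  have h1 : ∫ ω, S ω ∂μ = ∫ ω, (S ω - Z (fun _ => a) ω) ∂μ := by
    rw [integral_sub hi hZa.1, hZa.2, sub_zero]
  have hσ : ∀ m : ℕ, 0 < M * (b - a) * d / 2 ^ (m + 1) := fun m => by positivity
  have hL : ∀ m : ℕ, (0 : ℝ) ≤ (m + 1) * d := fun m => by positivity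
  rw [h1, integral_eq_lintegral_of_nonneg_ae]
  rotate_left
  · refine ae_of_all _ fun ω => ?_
    obtain ⟨t, -, h2, h3⟩ := hsup ω
    simp only [Pi.zero_apply]
    rw [show S ω = Z t ω from h2]; linarith
  · exact (hi.sub hZa.1).aestronglyMeasurable
  apply ENNReal.toReal_le_of_le_ofReal hR
  calc ∫⁻ ω, ENNReal.ofReal (S ω - Z (fun _ => a) ω) ∂μ
      ≤ ∫⁻ ω, ∑' m : ℕ, ENNReal.ofReal
        (glev Z a b (M * (b - a) * d / 2 ^ (m + 1)) ((m + 1) * d) m ω) ∂μ := by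
        refine lintegral_mono fun ω => ?_
        obtain ⟨t, ht, h2, -⟩ := hsup ω
        rw [show S ω = Z t ω from h2]
        refine cube_le Z hab ω (hc ω) _ ?_ t ht
        intro n k hk
        refine (ENNReal.ofReal_le_ofReal
          (grid_le (L := fun m : ℕ => ((m : ℝ) + 1) * d) Z a b hσ ω n k hk)).trans ?_
        rw [ENNReal.ofReal_sum_of_nonneg fun m _ => glev_nonneg Z a b (hσ m) (hL m) m ω]
        exact ENNReal.sum_le_tsum _
    _ = ∑' m : ℕ, ∫⁻ ω, ENNReal.ofReal
        (glev Z a b (M * (b - a) * d / 2 ^ (m + 1)) ((m + 1) * d) m ω) ∂μ :=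
        lintegral_tsum fun m => (glev_lint hd hab hM hZ hinc m).1
    _ ≤ ∑' m : ℕ, ENNReal.ofReal (gcst d m * (M * (b - a))) :=
        ENNReal.tsum_le_tsum fun m => (glev_lint hd hab hM hZ hinc m).2
    _ = ENNReal.ofReal ((∑' m, gcst d m) * M * (b - a)) := by
        rw [← ENNReal.ofReal_tsum_of_nonneg
          (fun m => mul_nonneg (gcst_nonneg d m) (by positivity))
          ((gcst_summable d).mul_right _), tsum_mul_right, mul_assoc]

/-- **Expected supremum bound.** For each dimension `d ≥ 1` there is a finite constant
`K_d` such that any centered Gaussian process on the cube `[a,b]^d` with continuous sample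
paths and `E[(Z_t - Z_s)²] ≤ M² ‖t-s‖²` satisfies `E[sup_{[a,b]^d} Z] ≤ K_d M (b-a)`. -/
theorem gaussian_sup_bound (d : ℕ) (hd : 1 ≤ d) :
    ∃ K : ℝ, ∀ (a b M : ℝ), a < b → 0 ≤ M →
      ∀ (Ω : Type) [MeasurableSpace Ω] (μ : Measure Ω) [IsProbabilityMeasure μ]
        (Z : (Fin d → ℝ) → Ω → ℝ),
        IsCenteredGaussianProcess μ Z →
        (∀ ω, Continuous fun t => Z t ω) →
        (∀ s t : Fin d → ℝ, s ∈ Icc (fun _ => a) (fun _ => b) →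
          t ∈ Icc (fun _ => a) (fun _ => b) →
          (∫ ω, (Z t ω - Z s ω) ^ 2 ∂μ) ≤ M ^ 2 * ∑ i, (t i - s i) ^ 2) →
        (∫ ω, (⨆ p : (Icc (fun _ => a) (fun _ => b) : Set (Fin d → ℝ)), Z p.1 ω) ∂μ) ≤
          K * M * (b - a) := by

  refine ⟨∑' m, gcst d m, ?_⟩
  intro a b M hab hM Ω _ μ _ Z hZ hc hinc
  have hlim : Tendsto (fun M' : ℝ => (∑' m, gcst d m) * M' * (b - a)) (nhdsWithin M (Ioi M))
      (nhds ((∑' m, gcst d m) * M * (b - a))) :=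
    (Continuous.tendsto (by fun_prop) M).mono_left nhdsWithin_le_nhds
  refine ge_of_tendsto hlim ?_
  filter_upwards [self_mem_nhdsWithin] with M' hM'
  have hM'' : M < M' := hM'
  refine main_pos hd hab (hM.trans_lt hM'') hZ hc ?_
  intro s t hs ht
  refine (hinc s t hs ht).trans ?_
  gcongr
end
end
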